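/- arXiv:2309.11885 — 2 statements merged into one kernel-verified Lean document; each statement's English description precedes it below -/
import Mathlib

section
/- Let u and v be adjacent vertices in a finite tree T, and let T' be obtained from T by the Kelmans operation from v to u. Then μ(T; v) ≥ μ(T'; u), with equality if and only if the component of T − v containing u is a path with u as a leaf (including the case that this component is the single vertex u). -/
open Finset Polynomial

variable {V : Type*}

/-- The vertex sets of the subtrees of `G` that lie inside the set `S` and contain
the vertex `w` : nonempty connected induced subgraphs. -/
noncomputable def subtreesIn [Fintype V] [DecidableEq V] (G : SimpleGraph V) (S : Set V)
    (w : V) : Finset (Finset V) := by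
  classical
  exact Finset.univ.filter fun A => w ∈ A ∧ (A : Set V) ⊆ S ∧ (G.induce (A : Set V)).Connected

/-- The vertex sets of the subtrees of `G` containing `w`. -/
noncomputable def subtrees [Fintype V] [DecidableEq V] (G : SimpleGraph V) (w : V) :
    Finset (Finset V) := subtreesIn G Set.univ w

/-- The generating polynomial `φ_{T,w}` of subtrees of `G` inside `S` containing `w`,
counted by order. -/
noncomputable def subtreePolyIn [Fintype V] [DecidableEq V] (G : SimpleGraph V) (S : Set V)
    (w : V) : Polynomial ℝ := ∑ A ∈ subtreesIn G S w, X ^ A.card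

/-- The generating polynomial `φ_{T,w}` of subtrees of `G` containing `w`. -/
noncomputable def subtreePoly [Fintype V] [DecidableEq V] (G : SimpleGraph V) (w : V) :
    Polynomial ℝ := subtreePolyIn G Set.univ w

/-- The local mean subtree order `μ(G; w)`: the average order of subtrees of `G`
containing `w`. -/
noncomputable def meanOrder [Fintype V] [DecidableEq V] (G : SimpleGraph V) (w : V) : ℝ :=
  (∑ A ∈ subtrees G w, (A.card : ℝ)) / ((subtrees G w).card : ℝ)

/-- The vertex set of the connected component of `G - D` containing `w`. -/
def compDel (G : SimpleGraph V) (D : Set V) (w : V) : Set V :=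
  {x | ∃ p : G.Walk w x, ∀ y ∈ p.support, y ∉ D}

/-- The neighbours of `u` as a `Finset`. -/
noncomputable def nbrFinset [Fintype V] (G : SimpleGraph V) (u : V) : Finset V := by
  classical
  exact Finset.univ.filter fun w => G.Adj u w

/-- `G` is a path: a tree all of whose vertices have degree at most `2`. -/
def IsPathGraph [Fintype V] (G : SimpleGraph V) : Prop :=
  G.IsTree ∧ ∀ v : V, (G.neighborSet v).ncard ≤ 2

/-- The induced subgraph of `G` on `S` is a path (as a subgraph of a tree:
connected with all degrees within `S` at most `2`). -/
def IsPathOn (G : SimpleGraph V) (S : Set V) : Prop :=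
  (G.induce S).Connected ∧ ∀ x ∈ S, (G.neighborSet x ∩ S).ncard ≤ 2

/-- The partial Kelmans operation on `G` from `v` to `u`, moving the edges between
`v` and the set `W`: each edge `v w`, `w ∈ W`, is replaced by the edge `u w`. -/
def pkelmans (G : SimpleGraph V) (v u : V) (W : Set V) : SimpleGraph V :=
  SimpleGraph.fromRel fun a b =>
    (G.Adj a b ∧ ¬(a = v ∧ b ∈ W) ∧ ¬(b = v ∧ a ∈ W)) ∨
    (a = u ∧ b ∈ W ∧ G.Adj v b)

/-- The Kelmans operation on `G` from `v` to `u`: every edge `v w` with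
`w ∈ N(v) \ {u}` is replaced by the edge `u w`. -/
def kelmans (G : SimpleGraph V) (v u : V) : SimpleGraph V :=
  pkelmans G v u (G.neighborSet v \ {u})

/-- Induction principle along the edges of `G` inside `S`, starting from `w`. For `w ∈ S` this
says that `G.induce S` is connected. -/
def SpreadsOn (G : SimpleGraph V) (S : Set V) (w : V) : Prop :=
  ∀ P : V → Prop, P w → (∀ x ∈ S, ∀ y ∈ S, G.Adj x y → P x → P y) → ∀ x ∈ S, P x

lemma induce_connected_iff_spreadsOn (G : SimpleGraph V) {S : Set V} {w : V} (hw : w ∈ S) :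
    (G.induce S).Connected ↔ SpreadsOn G S w := by
  constructor
  · intro h P hP hstep x hx
    obtain ⟨p⟩ := h.preconnected ⟨w, hw⟩ ⟨x, hx⟩
    have key : ∀ {a b : S} (_ : (G.induce S).Walk a b), P a → P b := by
      intro a b q
      induction q with
      | nil => exact id
      | cons hadj _ ih => exact fun ha => ih (hstep _ (Subtype.prop _) _ (Subtype.prop _) hadj ha)
    exact key p hP
  · intro h
    rw [SimpleGraph.connected_iff_exists_forall_reachable]
    refine ⟨⟨w, hw⟩, fun x => ?_⟩
    obtain ⟨x, hx⟩ := x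
    have := h (fun y => ∃ hy : y ∈ S, (G.induce S).Reachable ⟨w, hw⟩ ⟨y, hy⟩) ⟨hw, .rfl⟩
      (fun a ha b hb hab ⟨_, hr⟩ => ⟨hb, hr.trans (SimpleGraph.Adj.reachable
        (by simpa using hab))⟩) x hx
    exact this.2

lemma mem_subtreesIn [Fintype V] [DecidableEq V] {G : SimpleGraph V} {S : Set V} {w : V}
    {A : Finset V} :
    A ∈ subtreesIn G S w ↔ w ∈ A ∧ (A : Set V) ⊆ S ∧ SpreadsOn G (A : Set V) w := by
  classical
  simp only [subtreesIn, mem_filter, mem_univ, true_and]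
  constructor
  · rintro ⟨h1, h2, h3⟩
    exact ⟨h1, h2, (induce_connected_iff_spreadsOn G (by exact_mod_cast h1)).1 h3⟩
  · rintro ⟨h1, h2, h3⟩
    exact ⟨h1, h2, (induce_connected_iff_spreadsOn G (by exact_mod_cast h1)).2 h3⟩

lemma SpreadsOn.singleton (G : SimpleGraph V) (w : V) : SpreadsOn G {w} w := by
  rintro P hP - x rfl
  exact hP

lemma SpreadsOn.insert_adj {G : SimpleGraph V} {S : Set V} {w x y : V} (h : SpreadsOn G S w)
    (hx : x ∈ S) (hxy : G.Adj x y) : SpreadsOn G (insert y S) w := by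
  intro P hP hstep
  have hS : ∀ z ∈ S, P z := h P hP fun a ha b hb => hstep a (.inr ha) b (.inr hb)
  rintro z (rfl | hz)
  · exact hstep x (.inr hx) _ (.inl rfl) hxy (hS x hx)
  · exact hS z hz

/-- A connected set containing `w` contains connected subsets through `w` of all smaller sizes. -/
lemma SpreadsOn.exists_subset_card [DecidableEq V] {G : SimpleGraph V} {S : Finset V} {w : V}
    (hw : w ∈ S) (h : SpreadsOn G (S : Set V) w) {k : ℕ} (hk : 1 ≤ k) (hkS : k ≤ S.card) :
    ∃ C ⊆ S, w ∈ C ∧ SpreadsOn G (C : Set V) w ∧ C.card = k := by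
  induction k, hk using Nat.le_induction with
  | base => exact ⟨{w}, by simpa using hw, by simp, by simpa using SpreadsOn.singleton G w, by simp⟩
  | succ k hk ih =>
    obtain ⟨C, hCS, hwC, hC, hcard⟩ := ih (by omega)
    have hex : ∃ x ∈ C, ∃ y ∈ S, y ∉ C ∧ G.Adj x y := by
      by_contra! hno
      have : S ⊆ C := fun x hx => h (· ∈ C) hwC (fun a _ b hb hab ha => by
        by_contra hbC
        exact hno a ha b hb hbC hab) x hx
      have := card_le_card this
      omega
    obtain ⟨x, hx, y, hy, hyC, hxy⟩ := hex
    refine ⟨insert y C, insert_subset hy hCS, by simp [hwC], ?_, by simp [hyC, hcard]⟩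
    rw [coe_insert]
    exact hC.insert_adj (by exact_mod_cast hx) hxy

/-- If every member of `F` contains members of `F` of all smaller positive sizes, then the
total size of `F` is at most `|F| (|F| + 1) / 2`, with equality exactly for chains. -/
lemma two_mul_sum_card_le [DecidableEq V] {F : Finset (Finset V)}
    (hne : ∀ S ∈ F, S.Nonempty)
    (hF : ∀ S ∈ F, ∀ k, 1 ≤ k → k ≤ S.card → ∃ C ∈ F, C ⊆ S ∧ C.card = k) :
    2 * ∑ S ∈ F, S.card ≤ F.card * (F.card + 1) ∧
      (2 * ∑ S ∈ F, S.card = F.card * (F.card + 1) ↔ ∀ S ∈ F, ∀ C ∈ F, C ⊆ S ∨ S ⊆ C) := by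
  set N := (F ×ˢ F).filter fun p => p.2 ⊆ p.1 with hN
  set M := (F ×ˢ F).filter fun p => p.1 ⊆ p.2 with hM
  have hNM : N.card = M.card :=
    card_nbij' Prod.swap Prod.swap (by simp +contextual [hN, hM, Set.MapsTo])
      (by simp +contextual [hN, hM, Set.MapsTo]) (by simp [Set.LeftInvOn])
      (by simp [Set.LeftInvOn])
  have hinter : (N ∩ M).card = F.card := by
    refine card_nbij' Prod.fst (fun S => (S, S)) ?_ ?_ ?_ ?_
    · simp +contextual [hN, hM, Set.MapsTo]
    · simp +contextual [hN, hM, Set.MapsTo]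
    · rintro ⟨S, C⟩ h
      simp only [hN, hM, coe_inter, coe_filter, mem_product, Set.mem_inter_iff,
        Set.mem_ofPred_eq] at h
      simp [Subset.antisymm h.1.2 h.2.2]
    · simp [Set.LeftInvOn]
  have hunion : N ∪ M ⊆ F ×ˢ F := union_subset (filter_subset _ _) (filter_subset _ _)
  have hcu := card_union_add_card_inter N M
  have hcard : (F ×ˢ F).card = F.card * F.card := card_product _ _
  have hle := card_le_card hunion
  have hNsum : N.card = ∑ S ∈ F, (F.filter fun C => C ⊆ S).card := by
    simp only [hN, card_filter, sum_product]
  have hS : ∀ S ∈ F, S.card ≤ (F.filter fun C => C ⊆ S).card := by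
    intro S hSF
    have : Icc 1 S.card ⊆ (F.filter fun C => C ⊆ S).image card := by
      intro k hk
      rw [mem_Icc] at hk
      obtain ⟨C, hC, hCS, hk⟩ := hF S hSF k hk.1 hk.2
      exact mem_image.2 ⟨C, by simp [hC, hCS], hk⟩
    simpa using (card_le_card this).trans card_image_le
  have hsum : ∑ S ∈ F, S.card ≤ N.card := hNsum ▸ sum_le_sum hS
  have hring : F.card * (F.card + 1) = F.card * F.card + F.card := by ring
  refine ⟨by omega, fun heq => ?_, fun hch => ?_⟩
  · have huniv : N ∪ M = F ×ˢ F := eq_of_subset_of_card_le hunion (by omega)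
    intro S hS C hC
    have : (S, C) ∈ N ∪ M := huniv ▸ mk_mem_product hS hC
    simpa [hN, hM, hS, hC] using this
  · have huniv : N ∪ M = F ×ˢ F := by
      refine Subset.antisymm hunion ?_
      rintro ⟨S, C⟩ h
      rw [mem_product] at h
      simpa [hN, hM, h.1, h.2] using hch S h.1 C h.2
    have hS' : ∀ S ∈ F, (F.filter fun C => C ⊆ S).card ≤ S.card := by
      intro S hSF
      have hinj : Set.InjOn card (F.filter fun C => C ⊆ S : Set (Finset V)) := by
        intro C hC D hD hCD
        rw [mem_coe, mem_filter] at hC hD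
        rcases hch C hC.1 D hD.1 with h | h
        · exact (eq_of_subset_of_card_le h hCD.le).symm
        · exact eq_of_subset_of_card_le h hCD.ge
      have := card_le_card_of_injOn (s := F.filter fun C => C ⊆ S) (t := Icc 1 S.card) card
        (fun C hC => by
          simp only [coe_filter, Set.mem_ofPred_eq] at hC
          simpa using ⟨hne C hC.1, card_le_card hC.2⟩)
        (by simpa using hinj)
      simpa using this
    have : N.card ≤ ∑ S ∈ F, S.card := hNsum ▸ sum_le_sum hS'
    rw [huniv] at hcu
    omega

lemma SpreadsOn.exists_rank {G : SimpleGraph V} {A : Set V} {u : V} (hu : u ∈ A)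
    (h : SpreadsOn G A u) :
    ∃ f : V → ℕ, f u = 0 ∧ (∀ x ∈ A, ∀ y ∈ A, G.Adj x y → f y ≤ f x + 1) ∧
      ∀ x ∈ A, x ≠ u → ∃ z ∈ A, G.Adj z x ∧ f x = f z + 1 := by
  classical
  have hc := (induce_connected_iff_spreadsOn G hu).2 h
  set H := G.induce A
  have hf : ∀ x (hx : x ∈ A),
      (fun x => if hx : x ∈ A then H.dist ⟨x, hx⟩ ⟨u, hu⟩ else 0) x = H.dist ⟨x, hx⟩ ⟨u, hu⟩ :=
    fun x hx => dif_pos hx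
  have hstep : ∀ x (hx : x ∈ A), ∀ y (hy : y ∈ A), G.Adj x y →
      H.dist ⟨y, hy⟩ ⟨u, hu⟩ ≤ H.dist ⟨x, hx⟩ ⟨u, hu⟩ + 1 := by
    intro x hx y hy hxy
    have hadj : H.Adj ⟨y, hy⟩ ⟨x, hx⟩ := hxy.symm
    have := hc.dist_triangle (u := ⟨y, hy⟩) (v := ⟨x, hx⟩) (w := ⟨u, hu⟩)
    rw [SimpleGraph.dist_eq_one_iff_adj.2 hadj] at this
    omega
  refine ⟨fun x => if hx : x ∈ A then H.dist ⟨x, hx⟩ ⟨u, hu⟩ else 0, ?_, ?_, ?_⟩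
  · rw [hf u hu, SimpleGraph.dist_self]
  · intro x hx y hy hxy
    rw [hf x hx, hf y hy]
    exact hstep x hx y hy hxy
  · intro x hx hxu
    obtain ⟨p, hp⟩ := hc.exists_walk_length_eq_dist ⟨x, hx⟩ ⟨u, hu⟩
    cases p with
    | nil => exact absurd rfl hxu
    | @cons _ z _ hadj q =>
      have hzx : G.Adj z.1 x := SimpleGraph.Adj.symm (by exact hadj)
      refine ⟨z.1, z.2, hzx, ?_⟩
      rw [hf x hx, hf z.1 z.2]
      have h1 := hstep z.1 z.2 x hx hzx
      have h2 := SimpleGraph.dist_le q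
      rw [SimpleGraph.Walk.length_cons] at hp
      exact le_antisymm h1 (by change H.dist z _ + 1 ≤ _; omega)

/-- The connected subsets of `A` through `u` form a chain under inclusion iff `A` induces a path
with end vertex `u`. -/
lemma SpreadsOn.isChain_iff [Fintype V] [DecidableEq V] {G : SimpleGraph V} {A : Set V} {u : V}
    (hu : u ∈ A) (h : SpreadsOn G A u) :
    (∀ S ∈ subtreesIn G A u, ∀ C ∈ subtreesIn G A u, C ⊆ S ∨ S ⊆ C) ↔
      (∀ x ∈ A, (G.neighborSet x ∩ A).ncard ≤ 2) ∧ (G.neighborSet u ∩ A).ncard ≤ 1 := by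
  classical
  obtain ⟨f, hfu, hfstep, hfpred⟩ := h.exists_rank hu
  have hball : ∀ x ∈ A, SpreadsOn G (insert x {a ∈ A | f a < f x}) u := by
    intro x hx P hP hstep
    have key : ∀ n, ∀ a ∈ insert x {a ∈ A | f a < f x}, f a = n → P a := by
      intro n
      induction n with
      | zero =>
        intro a ha hfa
        have haA : a ∈ A := by rcases ha with rfl | ha; exacts [hx, ha.1]
        by_cases hau : a = u
        · exact hau ▸ hP
        · obtain ⟨z, -, -, hz⟩ := hfpred a haA hau
          omega
      | succ n ih =>
        intro a ha hfa
        have haA : a ∈ A := by rcases ha with rfl | ha; exacts [hx, ha.1]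
        have hau : a ≠ u := by rintro rfl; omega
        obtain ⟨z, hzA, hza, hz⟩ := hfpred a haA hau
        have hax : f a ≤ f x := by rcases ha with rfl | ha; exacts [le_rfl, ha.2.le]
        have hzmem : z ∈ insert x {a ∈ A | f a < f x} := .inr ⟨hzA, by omega⟩
        exact hstep z hzmem a ha hza (ih z hzmem (by omega))
    exact fun a ha => key _ a ha rfl
  have hballmem : ∀ x ∈ A, (insert x (univ.filter fun a => a ∈ A ∧ f a < f x)) ∈
      subtreesIn G A u := by
    intro x hx
    rw [mem_subtreesIn]
    refine ⟨?_, ?_, ?_⟩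
    · by_cases hxu : x = u
      · simp [hxu]
      · obtain ⟨z, -, -, hz⟩ := hfpred x hx hxu
        simp only [mem_insert, mem_filter, mem_univ, true_and]
        exact .inr ⟨hu, by omega⟩
    · intro a ha
      simp only [coe_insert, coe_filter, mem_univ, true_and] at ha
      rcases ha with rfl | ha
      exacts [hx, ha.1]
    · simpa using hball x hx
  have hinj : (∀ S ∈ subtreesIn G A u, ∀ C ∈ subtreesIn G A u, C ⊆ S ∨ S ⊆ C) ↔
      Set.InjOn f A := by
    constructor
    · intro hch x hx y hy hxy
      have aux : ∀ x y, f x = f y → insert x (univ.filter fun a => a ∈ A ∧ f a < f x) ⊆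
          insert y (univ.filter fun a => a ∈ A ∧ f a < f y) → x = y := by
        intro x y hxy hsub
        have := hsub (mem_insert_self _ _)
        simpa [hxy] using this
      rcases hch _ (hballmem x hx) _ (hballmem y hy) with h | h
      · exact (aux y x hxy.symm h).symm
      · exact aux x y hxy h
    · intro hinj S hS C hC
      have aux : ∀ S ∈ subtreesIn G A u, ∀ y ∈ S, ∀ x ∈ A, f x ≤ f y → x ∈ S := by
        intro S hS y hy x hx hxy
        rw [mem_subtreesIn] at hS
        obtain ⟨huS, hSA, hS⟩ := hS
        have := hS (fun y => ∀ n ≤ f y, ∃ a ∈ S, f a = n)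
          (fun n hn => ⟨u, huS, by omega⟩)
          (fun a ha b hb hab hPa n hn => by
            have := hfstep a (hSA ha) b (hSA hb) hab
            by_cases hna : n ≤ f a
            · exact hPa n hna
            · exact ⟨b, hb, by omega⟩) y hy _ hxy
        obtain ⟨a, ha, hax⟩ := this
        exact hinj (hSA ha) hx hax ▸ ha
      have hSA := (mem_subtreesIn.1 hS).2.1
      have hCA := (mem_subtreesIn.1 hC).2.1
      by_contra! hno
      obtain ⟨⟨x, hxC, hxS⟩, ⟨y, hyS, hyC⟩⟩ := And.imp not_subset.1 not_subset.1 hno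
      rcases le_total (f x) (f y) with hle | hle
      · exact hxS (aux S hS y hyS x (hCA hxC) hle)
      · exact hyC (aux C hC x hxC y (hSA hyS) hle)
  rw [hinj]
  constructor
  · intro hinj
    have hlt : ∀ x ∈ A, ∀ y ∈ G.neighborSet x ∩ A, f y = f x + 1 ∨ f y + 1 = f x := by
      rintro x hx y ⟨hxy, hy⟩
      rw [SimpleGraph.mem_neighborSet] at hxy
      have h1 := hfstep x hx y hy hxy
      have h2 := hfstep y hy x hx hxy.symm
      have h3 : f x ≠ f y := fun h => hxy.ne (hinj hx hy h)
      omega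
    constructor
    · intro x hx
      refine (Set.ncard_le_ncard_of_injOn f (t := {f x + 1, f x - 1}) ?_
        (hinj.mono Set.inter_subset_right)).trans (by simpa using Set.ncard_insert_le (f x + 1) {f x - 1})
      intro y hy
      rcases hlt x hx y hy with h | h
      · exact .inl h
      · exact .inr (show f y = _ by omega)
    · refine (Set.ncard_le_ncard_of_injOn f (t := {1}) ?_
        (hinj.mono Set.inter_subset_right)).trans (Set.ncard_singleton _).le
      intro y hy
      have := hlt u hu y hy
      show f y = 1
      omega
  · rintro ⟨hdeg, hdegu⟩
    have key : ∀ n, ∀ x ∈ A, ∀ y ∈ A, f x = n → f y = n → x = y := by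
      intro n
      induction n with
      | zero =>
        have aux : ∀ x ∈ A, f x = 0 → x = u := by
          intro x hx hfx
          by_contra hxu
          obtain ⟨z, -, -, hz⟩ := hfpred x hx hxu
          omega
        intro x hx y hy hfx hfy
        rw [aux x hx hfx, aux y hy hfy]
      | succ n ih =>
        intro x hx y hy hfx hfy
        obtain ⟨z, hz, hzx, hfz⟩ := hfpred x hx (by rintro rfl; omega)
        obtain ⟨z', hz', hzy, hfz'⟩ := hfpred y hy (by rintro rfl; omega)
        obtain rfl := ih z hz z' hz' (by omega) (by omega)
        by_contra hxy
        by_cases hzu : z = u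
        · subst hzu
          have hsub : {x, y} ⊆ G.neighborSet z ∩ A := by
            rintro a (rfl | rfl)
            exacts [⟨hzx, hx⟩, ⟨hzy, hy⟩]
          have := Set.ncard_le_ncard hsub
          rw [Set.ncard_pair hxy] at this
          omega
        · obtain ⟨w, hw, hwz, hfw⟩ := hfpred z hz hzu
          have hsub : {x, y, w} ⊆ G.neighborSet z ∩ A := by
            rintro a (rfl | rfl | rfl)
            exacts [⟨hzx, hx⟩, ⟨hzy, hy⟩, ⟨hwz.symm, hw⟩]
          have hle := Set.ncard_le_ncard hsub
          have h3 : ({x, y, w} : Set V).ncard = 3 := Set.ncard_eq_three.2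
            ⟨x, y, w, hxy, by rintro rfl; omega, by rintro rfl; omega, rfl⟩
          have := hdeg z hz
          omega
    exact fun x hx y hy hxy => key _ x hx y hy hxy rfl

lemma mem_compDel_self (G : SimpleGraph V) {u v : V} (huv : u ≠ v) : u ∈ compDel G {v} u :=
  ⟨.nil, by simpa using huv⟩

lemma notMem_compDel (G : SimpleGraph V) (u v : V) : v ∉ compDel G {v} u :=
  fun ⟨p, hp⟩ => hp v p.end_mem_support rfl

lemma spreadsOn_compDel (G : SimpleGraph V) (u v : V) : SpreadsOn G (compDel G {v} u) u := by
  intro P hP hstep x ⟨p, hp⟩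
  have key : ∀ {a b : V} (q : G.Walk a b), (∀ y ∈ q.support, y ∉ ({v} : Set V)) →
      a ∈ compDel G {v} u → P a → P b := by
    intro a b q
    induction q with
    | nil => exact fun _ _ => id
    | @cons a c b hadj q ih =>
      rintro hq ⟨r, hr⟩ ha
      rw [SimpleGraph.Walk.support_cons] at hq
      have hc : c ∈ compDel G {v} u := by
        refine ⟨r.concat hadj, fun y hy => ?_⟩
        rw [SimpleGraph.Walk.support_concat, List.mem_append, List.mem_singleton] at hy
        rcases hy with hy | rfl
        · exact hr y hy
        · exact hq _ (.tail _ q.start_mem_support)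
      exact ih (fun y hy => hq y (.tail _ hy)) hc (hstep a ⟨r, hr⟩ c hc hadj ha)
  refine key p hp ⟨.nil, fun y hy => ?_⟩ hP
  rw [SimpleGraph.Walk.support_nil, List.mem_singleton] at hy
  exact hy ▸ hp u p.start_mem_support

/-- In an acyclic graph, `uv` is the only edge leaving the component of `u` in `G - v`. -/
lemma eq_of_adj_compDel {G : SimpleGraph V} (hG : G.IsAcyclic) {u v x y : V} (huv : G.Adj u v)
    (hx : x ∈ compDel G {v} u) (hy : y ∉ compDel G {v} u) (hxy : G.Adj x y) : x = u ∧ y = v := by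
  obtain ⟨p, hp⟩ := hx
  have hyv : y = v := by
    by_contra hyv
    refine hy ⟨p.concat hxy, fun z hz => ?_⟩
    rw [SimpleGraph.Walk.support_concat, List.mem_append, List.mem_singleton] at hz
    rcases hz with hz | rfl
    exacts [hp z hz, hyv]
  subst hyv
  refine ⟨?_, rfl⟩
  have hbr := SimpleGraph.isBridge_iff_forall_walk_mem_edges.1
    (SimpleGraph.isAcyclic_iff_forall_adj_isBridge.1 hG huv) (p.concat hxy)
  rw [SimpleGraph.Walk.edges_concat, List.concat_eq_append, List.mem_append, List.mem_singleton] at hbr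
  rcases hbr with h | h
  · exact absurd rfl (hp y (p.snd_mem_support_of_mem_edges h))
  · grind [Sym2.eq_iff, hxy.ne]

/-- The only edge of `G` between `A` and its complement is `uv`, with `u ∈ A`. -/
structure IsCutEdge (G : SimpleGraph V) (A : Set V) (u v : V) : Prop where
  adj : G.Adj u v
  mem : u ∈ A
  notMem : v ∉ A
  eq_of_adj : ∀ x ∈ A, ∀ y ∉ A, G.Adj x y → x = u ∧ y = v

lemma IsCutEdge.spreadsOn_iff {G : SimpleGraph V} {A : Set V} {u v : V} (h : IsCutEdge G A u v)
    {S : Set V} (hv : v ∈ S) :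
    SpreadsOn G S v ↔
      SpreadsOn G (S \ A) v ∧ (S ∩ A = ∅ ∨ u ∈ S ∧ SpreadsOn G (S ∩ A) u) := by
  constructor
  · intro hS
    refine ⟨fun P hP hstep => ?_, ?_⟩
    · have := hS (fun x => x ∉ A → P x) (fun _ => hP) (fun x hx y hy hxy hPx hyA => by
        by_cases hxA : x ∈ A
        · rwa [(h.eq_of_adj x hxA y hyA hxy).2]
        · exact hstep x ⟨hx, hxA⟩ y ⟨hy, hyA⟩ hxy (hPx hxA))
      exact fun x hx => this x hx.1 hx.2
    · rw [or_iff_not_imp_left]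
      intro hne
      obtain ⟨z, hzS, hzA⟩ := Set.nonempty_iff_ne_empty.2 hne
      have hu : u ∈ S := hS (fun x => x ∈ A → u ∈ S) (fun hvA => absurd hvA h.notMem)
        (fun x hx y hy hxy hPx hyA => by
          by_cases hxA : x ∈ A
          · exact hPx hxA
          · exact (h.eq_of_adj y hyA x hxA hxy.symm).1 ▸ hy) z hzS hzA
      refine ⟨hu, fun P hP hstep => ?_⟩
      have := hS (fun x => x ∈ A → P x) (fun hvA => absurd hvA h.notMem)
        (fun x hx y hy hxy hPx hyA => by
          by_cases hxA : x ∈ A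
          · exact hstep x ⟨hx, hxA⟩ y ⟨hy, hyA⟩ hxy (hPx hxA)
          · rwa [(h.eq_of_adj y hyA x hxA hxy.symm).1])
      exact fun x hx => this x hx.1 hx.2
  · rintro ⟨hB, hA⟩ P hP hstep x hx
    have hPB := hB P hP fun a ha b hb => hstep a ha.1 b hb.1
    by_cases hxA : x ∈ A
    · rcases hA with hA | ⟨hu, hA⟩
      · exact absurd (show x ∈ S ∩ A from ⟨hx, hxA⟩) (by simp [hA])
      · exact hA P (hstep v hv u hu h.adj.symm hP) (fun a ha b hb => hstep a ha.1 b hb.1) x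
          ⟨hx, hxA⟩
    · exact hPB x ⟨hx, hxA⟩

lemma kelmans_adj {G : SimpleGraph V} {u v : V} (huv : G.Adj u v) (x y : V) :
    (kelmans G v u).Adj x y ↔
      x ≠ y ∧ (((x ≠ v ∧ y ≠ v ∨ s(x, y) = s(u, v)) ∧ G.Adj x y) ∨
        (x = u ∧ y ≠ u ∧ G.Adj v y) ∨ (y = u ∧ x ≠ u ∧ G.Adj v x)) := by
  have := huv.ne
  simp only [kelmans, pkelmans, SimpleGraph.fromRel_adj, Set.mem_sdiff, SimpleGraph.mem_neighborSet,
    Set.mem_singleton_iff, Sym2.eq_iff]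
  have h1 := G.adj_comm x y
  have h2 := G.adj_comm v x
  have h3 := G.adj_comm v y
  grind

lemma IsCutEdge.spreadsOn_kelmans_iff {G : SimpleGraph V} {A : Set V} {u v : V}
    (h : IsCutEdge G A u v) {S : Set V} (hu : u ∈ S) :
    SpreadsOn (kelmans G v u) S u ↔
      SpreadsOn G (S ∩ A) u ∧ SpreadsOn G (insert v (S \ A)) v := by
  have huv := h.adj.ne
  have huA := h.mem
  have hvA := h.notMem
  have hin : ∀ x ∈ A, ∀ y ∈ A, ((kelmans G v u).Adj x y ↔ G.Adj x y) := by
    intro x hx y hy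
    have hxv : x ≠ v := fun e => hvA (e ▸ hx)
    have hyv : y ≠ v := fun e => hvA (e ▸ hy)
    have h1 := h.eq_of_adj x hx v hvA
    have h2 := h.eq_of_adj y hy v hvA
    have h3 := G.adj_comm v x
    have h4 := G.adj_comm v y
    have h5 : G.Adj x y → x ≠ y := fun h => h.ne
    rw [kelmans_adj h.adj]
    grind
  have hout : ∀ x ∉ A, ∀ y ∉ A, x ≠ v → y ≠ v → ((kelmans G v u).Adj x y ↔ G.Adj x y) := by
    intro x hx y hy hxv hyv
    have hxu : x ≠ u := fun e => hx (e ▸ huA)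
    have hyu : y ≠ u := fun e => hy (e ▸ huA)
    have h5 : G.Adj x y → x ≠ y := fun h => h.ne
    rw [kelmans_adj h.adj]
    grind
  have hcross : ∀ x ∈ A, ∀ y ∉ A, ((kelmans G v u).Adj x y ↔ x = u ∧ (y = v ∨ G.Adj v y)) := by
    intro x hx y hy
    have hxy : x ≠ y := fun e => hy (e ▸ hx)
    have hyu : y ≠ u := fun e => hy (e ▸ huA)
    have h1 := h.eq_of_adj x hx y hy
    have h2 := h.adj
    rw [kelmans_adj h.adj]
    grind
  have hvadj : ∀ y ∉ A, ¬ (kelmans G v u).Adj v y := by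
    intro y hy
    have hyu : y ≠ u := fun e => hy (e ▸ huA)
    rw [kelmans_adj h.adj]
    grind
  constructor
  · intro hS
    constructor
    · intro P hP hstep
      have := hS (fun x => x ∈ A → P x) (fun _ => hP) (fun x hx y hy hxy hPx hyA => by
        by_cases hxA : x ∈ A
        · exact hstep x ⟨hx, hxA⟩ y ⟨hy, hyA⟩ ((hin x hxA y hyA).1 hxy) (hPx hxA)
        · rwa [((hcross y hyA x hxA).1 hxy.symm).1])
      exact fun x hx => this x hx.1 hx.2
    · intro P hP hstep
      have := hS (fun x => x ∉ A → P x) (fun huA' => absurd huA huA')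
        (fun x hx y hy hxy hPx hyA => by
          by_cases hyv : y = v
          · rwa [hyv]
          by_cases hxA : x ∈ A
          · have := (((hcross x hxA y hyA).1 hxy).2).resolve_left hyv
            exact hstep v (.inl rfl) y (.inr ⟨hy, hyA⟩) this hP
          · have hxv : x ≠ v := by rintro rfl; exact hvadj y hyA hxy
            exact hstep x (.inr ⟨hx, hxA⟩) y (.inr ⟨hy, hyA⟩)
              ((hout x hxA y hyA hxv hyv).1 hxy) (hPx hxA))
      rintro x (rfl | hx)
      exacts [hP, this x hx.1 hx.2]
  · rintro ⟨hA, hB⟩ P hP hstep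
    have hPA := hA P hP fun a ha b hb hab => hstep a ha.1 b hb.1 ((hin a ha.2 b hb.2).2 hab)
    have hPB := hB (fun x => x ∈ S → P x)
      (fun hvS => hstep u hu v hvS ((hcross u huA v hvA).2 ⟨rfl, .inl rfl⟩) hP)
      (fun x hx y hy hxy hPx hyS => by
        have hxA : x ∉ A := by rcases hx with rfl | hx; exacts [hvA, hx.2]
        have hyA : y ∉ A := by rcases hy with rfl | hy; exacts [hvA, hy.2]
        by_cases hyv : y = v
        · exact hstep u hu y hyS ((hcross u huA y hyA).2 ⟨rfl, .inl hyv⟩) hP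
        by_cases hxv : x = v
        · exact hstep u hu y hyS ((hcross u huA y hyA).2 ⟨rfl, .inr (hxv ▸ hxy)⟩) hP
        have hxS : x ∈ S := by rcases hx with hx | hx; exacts [absurd hx hxv, hx.1]
        exact hstep x hxS y hyS ((hout x hxA y hyA hxv hyv).2 hxy) (hPx hxS))
    intro x hx
    by_cases hxA : x ∈ A
    · exact hPA x ⟨hx, hxA⟩
    · exact hPB x (.inr ⟨hx, hxA⟩) hx

lemma IsCutEdge.sum_subtrees [Fintype V] [DecidableEq V] {G : SimpleGraph V} {A : Set V} {u v : V}
    (h : IsCutEdge G A u v) (g : ℕ → ℝ) :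
    ∑ S ∈ subtrees G v, g S.card = ∑ p ∈ subtreesIn G Aᶜ v ×ˢ insert ∅ (subtreesIn G A u),
      g (p.1.card + p.2.card) := by
  classical
  have hsplit : ∀ p ∈ subtreesIn G Aᶜ v ×ˢ insert ∅ (subtreesIn G A u),
      (p.1 : Set V) ⊆ Aᶜ ∧ (p.2 : Set V) ⊆ A := by
    rintro ⟨Y, X⟩ hp
    simp only [mem_product, mem_insert, mem_subtreesIn] at hp
    refine ⟨hp.1.2.1, ?_⟩
    rcases hp.2 with hX | hX
    · simp [hX]
    · exact hX.2.1
  refine sum_nbij' (fun S => (S.filter (· ∉ A), S.filter (· ∈ A))) (fun p => p.1 ∪ p.2)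
    ?_ ?_ ?_ ?_ ?_
  · intro S hS
    rw [subtrees, mem_subtreesIn] at hS
    obtain ⟨hv, -, hS⟩ := hS
    rw [h.spreadsOn_iff hv] at hS
    simp only [mem_product, mem_insert, mem_subtreesIn, coe_filter, mem_filter]
    refine ⟨⟨⟨hv, h.notMem⟩, fun x hx => hx.2, hS.1⟩, ?_⟩
    rcases hS.2 with hA | hA
    · left
      rw [← coe_inj, coe_filter, coe_empty]
      exact hA
    · exact .inr ⟨⟨hA.1, h.mem⟩, fun x hx => hx.2, hA.2⟩
  · intro p hp
    obtain ⟨hY, hX⟩ := hsplit p hp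
    obtain ⟨Y, X⟩ := p
    simp only [mem_product, mem_insert, mem_subtreesIn] at hp hX hY
    have hv : v ∈ Y ∪ X := mem_union_left _ hp.1.1
    rw [subtrees, mem_subtreesIn]
    refine ⟨hv, Set.subset_univ _, ?_⟩
    rw [h.spreadsOn_iff (by exact_mod_cast hv)]
    have e1 : ((Y ∪ X : Finset V) : Set V) \ A = Y := by
      ext x
      have h1 := @hX x
      have h2 := @hY x
      simp only [Set.mem_compl_iff] at h2
      simp only [coe_union, Set.mem_sdiff, Set.mem_union]
      tauto
    have e2 : ((Y ∪ X : Finset V) : Set V) ∩ A = X := by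
      ext x
      have h1 := @hX x
      have h2 := @hY x
      simp only [Set.mem_compl_iff] at h2
      simp only [coe_union, Set.mem_inter_iff, Set.mem_union]
      tauto
    rw [e1, e2]
    refine ⟨hp.1.2.2, ?_⟩
    rcases hp.2 with hX | hX
    · simp [hX]
    · exact .inr ⟨by simp [hX.1], hX.2.2⟩
  · intro S _
    ext x
    simp only [mem_union, mem_filter]
    tauto
  · intro p hp
    obtain ⟨hY, hX⟩ := hsplit p hp
    refine Prod.ext ?_ ?_ <;> ext x <;>
    · have h1 := @hX x
      have h2 := @hY x
      simp only [Set.mem_compl_iff, mem_coe] at h1 h2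
      simp only [mem_union, mem_filter]
      tauto
  · intro S _
    have := card_filter_add_card_filter_not (s := S) (· ∈ A)
    rw [add_comm] at this
    simp only [this]

lemma IsCutEdge.sum_subtrees_kelmans [Fintype V] [DecidableEq V] {G : SimpleGraph V} {A : Set V}
    {u v : V} (h : IsCutEdge G A u v) (g : ℕ → ℝ) :
    ∑ S ∈ subtrees (kelmans G v u) u, g S.card =
      ∑ p ∈ (subtreesIn G Aᶜ v ×ˢ subtreesIn G A u) ×ˢ ({∅, {v}} : Finset (Finset V)),
        g (p.1.1.card - 1 + p.1.2.card + p.2.card) := by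
  classical
  have huv := h.adj.ne
  have huA := h.mem
  have hvA := h.notMem
  have hsplit : ∀ p ∈ (subtreesIn G Aᶜ v ×ˢ subtreesIn G A u) ×ˢ ({∅, {v}} : Finset (Finset V)),
      v ∈ p.1.1 ∧ (p.1.1 : Set V) ⊆ Aᶜ ∧ (p.1.2 : Set V) ⊆ A ∧ (∀ x ∈ p.2, x = v) := by
    rintro ⟨⟨Y, X⟩, Z⟩ hp
    simp only [mem_product, mem_insert, mem_singleton, mem_subtreesIn] at hp
    refine ⟨hp.1.1.1, hp.1.1.2.1, hp.1.2.2.1, ?_⟩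
    rcases hp.2 with hZ | hZ <;> simp [hZ]
  refine sum_nbij' (fun S => ((insert v (S.filter (· ∉ A)), S.filter (· ∈ A)), S.filter (· = v)))
    (fun p => p.1.1.erase v ∪ p.1.2 ∪ p.2) ?_ ?_ ?_ ?_ ?_
  · intro S hS
    rw [subtrees, mem_subtreesIn] at hS
    obtain ⟨hu, -, hS⟩ := hS
    rw [h.spreadsOn_kelmans_iff hu] at hS
    simp only [mem_product, mem_insert, mem_singleton, mem_subtreesIn, coe_insert, coe_filter,
      mem_filter]
    refine ⟨⟨⟨by simp, ?_, hS.2⟩, ⟨hu, huA⟩, fun x hx => hx.2, hS.1⟩, ?_⟩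
    · rintro x (rfl | hx)
      exacts [hvA, hx.2]
    · by_cases hvS : v ∈ S
      · exact .inr (by ext x; simp only [mem_filter, mem_singleton]; grind)
      · exact .inl (by ext x; simp only [mem_filter, notMem_empty]; grind)
  · intro p hp
    obtain ⟨hvY, hY, hX, hZ⟩ := hsplit p hp
    obtain ⟨⟨Y, X⟩, Z⟩ := p
    simp only [mem_product, mem_subtreesIn] at hp hX hY hZ hvY
    have hu : u ∈ Y.erase v ∪ X ∪ Z := mem_union_left _ (mem_union_right _ hp.1.2.1)
    rw [subtrees, mem_subtreesIn]
    refine ⟨hu, Set.subset_univ _, ?_⟩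
    rw [h.spreadsOn_kelmans_iff (by exact_mod_cast hu)]
    have e1 : insert v (((Y.erase v ∪ X ∪ Z : Finset V) : Set V) \ A) = Y := by
      ext x
      have h1 := @hX x
      have h2 := @hY x
      have h3 := hZ x
      simp only [Set.mem_compl_iff, mem_coe] at h1 h2
      simp only [mem_coe, Set.mem_insert_iff, Set.mem_sdiff, mem_union, mem_erase]
      grind
    have e2 : ((Y.erase v ∪ X ∪ Z : Finset V) : Set V) ∩ A = X := by
      ext x
      have h1 := @hX x
      have h2 := @hY x
      have h3 := hZ x
      simp only [Set.mem_compl_iff, mem_coe] at h1 h2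
      simp only [mem_coe, Set.mem_inter_iff, mem_union, mem_erase]
      grind
    rw [e1, e2]
    exact ⟨hp.1.2.2.2, hp.1.1.2.2⟩
  · intro S _
    ext x
    simp only [mem_union, mem_erase, mem_insert, mem_filter]
    grind
  · intro p hp
    obtain ⟨hvY, hY, hX, hZ⟩ := hsplit p hp
    refine Prod.ext (Prod.ext ?_ ?_) ?_ <;> ext x <;>
    · have h1 := @hX x
      have h2 := @hY x
      have h3 := hZ x
      have h4 := @hX v
      simp only [Set.mem_compl_iff, mem_coe] at h1 h2 h4
      simp only [mem_union, mem_filter, mem_insert, mem_erase]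
      grind
  · intro S _
    have h1 := card_filter_add_card_filter_not (s := S) (· ∈ A)
    have h2 := card_filter_add_card_filter_not (s := S.filter (· ∉ A)) (· = v)
    have h3 : (S.filter (· ∉ A)).filter (· = v) = S.filter (· = v) := by
      ext x
      simp only [mem_filter]
      grind
    have h4 : insert v (S.filter (· ∉ A)) = insert v ((S.filter (· ∉ A)).filter (¬ · = v)) := by
      ext x
      simp only [mem_filter, mem_insert]
      grind
    have h5 : v ∉ (S.filter (· ∉ A)).filter (¬ · = v) := by simp
    rw [h3] at h2
    simp only [h4, card_insert_of_notMem h5]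
    congr 1
    omega

/-- For adjacent vertices `u, v` of a tree `T` and `T' = T_{(v→u)}`:
`μ(T; v) ≥ μ(T'; u)`, with equality iff the component of `T - v` containing `u` is a
path with `u` as a leaf (including the case where this component is just `{u}`). -/
theorem meanOrder_ge_kelmans {V : Type*} [Fintype V] [DecidableEq V]
    (G : SimpleGraph V) (hG : G.IsTree) (u v : V) (huv : G.Adj u v) :
    meanOrder G v ≥ meanOrder (kelmans G v u) u ∧
      (meanOrder G v = meanOrder (kelmans G v u) u ↔
        IsPathOn G (compDel G {v} u) ∧
          (G.neighborSet u ∩ compDel G {v} u).ncard ≤ 1) := by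
  classical
  set A := compDel G {v} u with hA
  have hcut : IsCutEdge G A u v := ⟨huv, mem_compDel_self G huv.ne, notMem_compDel G u v,
    fun x hx y hy hxy => eq_of_adj_compDel hG.isAcyclic huv hx hy hxy⟩
  have hsp : SpreadsOn G A u := spreadsOn_compDel G u v
  have hpath : (IsPathOn G A ∧ (G.neighborSet u ∩ A).ncard ≤ 1) ↔
      ∀ S ∈ subtreesIn G A u, ∀ C ∈ subtreesIn G A u, C ⊆ S ∨ S ⊆ C := by
    rw [hsp.isChain_iff hcut.mem, IsPathOn]
    exact and_congr_left' (and_iff_right ((induce_connected_iff_spreadsOn G hcut.mem).2 hsp))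
  have hF := two_mul_sum_card_le (F := subtreesIn G A u)
    (fun S hS => ⟨u, (mem_subtreesIn.1 hS).1⟩) (fun S hS k hk hkS => by
      obtain ⟨hu, hSA, hS⟩ := mem_subtreesIn.1 hS
      obtain ⟨C, hCS, huC, hC, hcard⟩ := hS.exists_subset_card hu hk hkS
      exact ⟨C, mem_subtreesIn.2 ⟨huC, fun x hx => hSA (hCS hx), hC⟩, hCS, hcard⟩)
  rw [hpath, ← hF.2]
  have hle := hF.1
  clear hF hpath
  have hFA : 0 < (subtreesIn G A u).card := card_pos.2 ⟨{u}, mem_subtreesIn.2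
    ⟨by simp, by simpa using hcut.mem, by simpa using SpreadsOn.singleton G u⟩⟩
  have hFB : 0 < (subtreesIn G Aᶜ v).card := card_pos.2 ⟨{v}, mem_subtreesIn.2
    ⟨by simp, by simpa using hcut.notMem, by simpa using SpreadsOn.singleton G v⟩⟩
  have hempty : ∅ ∉ subtreesIn G A u := fun h => notMem_empty _ (mem_subtreesIn.1 h).1
  have hYpos : ∀ Y ∈ subtreesIn G Aᶜ v, ((Y.card - 1 : ℕ) : ℝ) = Y.card - 1 := fun Y hY => by
    rw [Nat.cast_sub (card_pos.2 ⟨v, (mem_subtreesIn.1 hY).1⟩), Nat.cast_one]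
  have hc1 := hcut.sum_subtrees fun _ => 1
  have hs1 := hcut.sum_subtrees fun n => n
  have hc2 := hcut.sum_subtrees_kelmans fun _ => 1
  have hs2 := hcut.sum_subtrees_kelmans fun n => n
  have hne : (∅ : Finset V) ≠ {v} := (singleton_ne_empty v).symm
  have hs2' : ∑ S ∈ subtrees (kelmans G v u) u, (S.card : ℝ) =
      ∑ Y ∈ subtreesIn G Aᶜ v, ∑ X ∈ subtreesIn G A u, (2 * Y.card - 1 + 2 * X.card : ℝ) := by
    rw [hs2, sum_product, sum_product]
    refine sum_congr rfl fun Y hY => sum_congr rfl fun X _ => ?_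
    rw [sum_pair hne]
    push_cast
    rw [hYpos Y hY]
    simp
    ring
  simp only [sum_const, nsmul_eq_mul, mul_one, card_product, card_insert_of_notMem hempty,
    card_pair hne] at hc1 hc2
  simp only [sum_product, sum_insert hempty, card_empty, Nat.cast_zero, Nat.cast_add, zero_add,
    sum_add_distrib, sum_const, nsmul_eq_mul, sum_sub_distrib, ← mul_sum, mul_one] at hs1 hs2'
  push_cast at hc1 hc2
  rw [meanOrder, meanOrder, hc1, hs1, hc2, hs2']
  have hle' : 2 * ∑ S ∈ subtreesIn G A u, (S.card : ℝ) ≤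
      (subtreesIn G A u).card * ((subtreesIn G A u).card + 1) := by exact_mod_cast hle
  have heq' : 2 * ∑ S ∈ subtreesIn G A u, S.card =
        (subtreesIn G A u).card * ((subtreesIn G A u).card + 1) ↔
      2 * ∑ S ∈ subtreesIn G A u, (S.card : ℝ) =
        (subtreesIn G A u).card * ((subtreesIn G A u).card + 1) := by norm_cast
  rw [heq']
  have ha : (0 : ℝ) < (subtreesIn G A u).card := by exact_mod_cast hFA
  have hb : (0 : ℝ) < (subtreesIn G Aᶜ v).card := by exact_mod_cast hFB
  generalize ((subtreesIn G A u).card : ℝ) = a at *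
  generalize ((subtreesIn G Aᶜ v).card : ℝ) = b at *
  generalize ∑ S ∈ subtreesIn G A u, (S.card : ℝ) = a' at *
  generalize ∑ S ∈ subtreesIn G Aᶜ v, (S.card : ℝ) = b' at *
  have hdiff : (b' + a * b' + b * a') / (b * (a + 1)) - (a * (2 * b' - b) + b * (2 * a')) /
      (b * a * 2) = (a * (a + 1) - 2 * a') / (2 * a * (a + 1)) := by
    field_simp
    ring
  rw [ge_iff_le, ← sub_nonneg, ← sub_eq_zero (b := _ / (b * a * 2)), hdiff]
  refine ⟨div_nonneg (by linarith) (by positivity), ?_⟩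
  rw [div_eq_zero_iff, or_iff_left (by positivity), sub_eq_zero, eq_comm]
end

section
/- Let u and v be adjacent vertices of a finite tree T, and let T' be obtained from T by a partial Kelmans operation from v to u, i.e., replacing edges vv_1,...,vv_s by uv_1,...,uv_s for some subset {v_1,...,v_s} of N(v)∖{u}. Then μ(T'; v) ≥ μ(T; v). Equality holds if and only if either s = 0 (so T' = T), or: u is a leaf of T, s = 1, and the component of T − {u,v} containing v_1 is a path with v_1 as a leaf. -/
open Finset Polynomial

variable {V : Type*}

section ParentMap

open Relation

/-- One step up towards the root `v` along the parent map `π`. -/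
def UpStep (π : V → V) (v a b : V) : Prop := a ≠ v ∧ b = π a

/-- `IsBelow π v x y`: the vertex `y` lies on the way from `x` to the root `v`. -/
def IsBelow (π : V → V) (v x y : V) : Prop := ReflTransGen (UpStep π v) x y

/-- `π` maps every vertex other than the root `v` to its parent in the tree `G`. -/
structure IsParentMap (G : SimpleGraph V) (v : V) (π : V → V) : Prop where
  adj_iff : ∀ a b, G.Adj a b ↔ UpStep π v a b ∨ UpStep π v b a
  isBelow_root : ∀ x, IsBelow π v x v

variable {π : V → V} {v : V}

theorem IsBelow.cases_head {x y : V} (h : IsBelow π v x y) :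
    x = y ∨ x ≠ v ∧ IsBelow π v (π x) y := by
  rcases ReflTransGen.cases_head h with h | ⟨z, ⟨h1, rfl⟩, h2⟩
  exacts [.inl h, .inr ⟨h1, h2⟩]

theorem IsBelow.cases_tail {x y : V} (h : IsBelow π v x y) :
    x = y ∨ ∃ z, z ≠ v ∧ π z = y ∧ IsBelow π v x z := by
  rcases ReflTransGen.cases_tail h with h | ⟨z, h2, ⟨h1, rfl⟩⟩
  exacts [.inl h.symm, .inr ⟨z, h1, rfl, h2⟩]

theorem isBelow_refl (x : V) : IsBelow π v x x := ReflTransGen.refl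

theorem IsBelow.trans {x y z : V} (h : IsBelow π v x y) (h' : IsBelow π v y z) :
    IsBelow π v x z := ReflTransGen.trans h h'

theorem isBelow_parent {x : V} (hx : x ≠ v) : IsBelow π v x (π x) :=
  ReflTransGen.single ⟨hx, rfl⟩

theorem IsBelow.eq_of_root {y : V} (h : IsBelow π v v y) : y = v := by
  rcases h.cases_head with h | h
  exacts [h.symm, absurd rfl h.1]

theorem IsBelow.depth_le {d : V → ℕ} (hd : ∀ x ≠ v, d (π x) < d x) {x y : V}
    (h : IsBelow π v x y) : d y ≤ d x := by
  induction h with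
  | refl => rfl
  | tail _ h ih =>
    obtain ⟨h1, rfl⟩ := h
    exact (hd _ h1).le.trans ih

/-- A vertex set is closed under taking parents, except at the members of `S`. -/
def UpClosed (π : V → V) (S : Set V) (A : Finset V) : Prop := ∀ x ∈ A, x ∉ S → π x ∈ A

theorem IsParentMap.induce_connected {G : SimpleGraph V} (hπ : IsParentMap G v π) {S : Set V}
    {r : V} (hr : r ∈ S) (hS : ∀ x ∈ S, x ≠ r → π x ∈ S) (hb : ∀ x ∈ S, IsBelow π v x r) :
    (G.induce S).Connected := by
  have key : ∀ x, IsBelow π v x r → ∀ hx : x ∈ S,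
      (G.induce S).Reachable ⟨x, hx⟩ ⟨r, hr⟩ := by
    intro x h
    induction h using ReflTransGen.head_induction_on with
    | refl => intro hx; rfl
    | @head a c h _ ih =>
      intro hx
      by_cases har : a = r
      · subst har; rfl
      · have hc : c ∈ S := h.2 ▸ hS _ hx har
        refine SimpleGraph.Reachable.trans (SimpleGraph.Adj.reachable ?_) (ih hc)
        simpa using (hπ.adj_iff a c).2 (.inl h)
  refine SimpleGraph.connected_iff_exists_forall_reachable _ |>.2 ⟨⟨r, hr⟩, ?_⟩
  rintro ⟨x, hx⟩
  exact (key x (hb x hx) hx).symm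

theorem IsParentMap.induce_connected_iff {G : SimpleGraph V} (hπ : IsParentMap G v π)
    {A : Finset V} (hv : v ∈ A) :
    (G.induce (A : Set V)).Connected ↔ UpClosed π {v} A := by
  constructor
  · intro h x hx hxv
    by_contra hp
    have hxv : x ≠ v := hxv
    obtain ⟨p⟩ := h.preconnected ⟨x, hx⟩ ⟨v, hv⟩
    have key : ∀ a b : (A : Set V), (G.induce (A : Set V)).Walk a b →
        IsBelow π v a x → IsBelow π v b x := by
      intro a b p
      induction p with
      | nil => exact id
      | @cons a c _ hadj _ ih =>
        intro ha
        apply ih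
        have hadj' : G.Adj a c := by simpa using hadj
        rcases (hπ.adj_iff _ _).1 hadj' with h | h
        · rcases ha.cases_head with h2 | h2
          · exact absurd (h2 ▸ h.2 ▸ c.2 : π x ∈ A) hp
          · rw [h.2]; exact h2.2
        · exact ReflTransGen.head h ha
    exact hxv (key _ _ p (isBelow_refl x)).eq_of_root
  · intro h
    exact hπ.induce_connected (by exact_mod_cast hv) (fun x hx hxv => h x hx hxv)
      (fun x _ => hπ.isBelow_root x)

theorem mem_subtrees_iff [Fintype V] [DecidableEq V] {G : SimpleGraph V}
    (hπ : IsParentMap G v π) {A : Finset V} :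
    A ∈ subtrees G v ↔ v ∈ A ∧ UpClosed π {v} A := by
  simp only [subtrees, subtreesIn, mem_filter, mem_univ, true_and, Set.subset_univ]
  exact and_congr_right fun hv => hπ.induce_connected_iff hv

theorem exists_isParentMap {G : SimpleGraph V} (hG : G.IsTree) (v : V) :
    ∃ (π : V → V) (d : V → ℕ), IsParentMap G v π ∧ ∀ x ≠ v, d (π x) < d x := by
  classical
  choose p hp hu using fun x => hG.existsUnique_path x v
  have hadj : ∀ x ≠ v, G.Adj x (p x).snd := fun x hx =>
    (p x).adj_snd (SimpleGraph.Walk.not_nil_of_ne hx)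
  have hd : ∀ x ≠ v, (p (p x).snd).length < (p x).length := by
    intro x hx
    have h1 : (p x).tail = p (p x).snd := hu _ _ (hp x).tail
    rw [← h1]
    have := SimpleGraph.Walk.length_tail_add_one (p := p x) (SimpleGraph.Walk.not_nil_of_ne hx)
    omega
  refine ⟨fun x => (p x).snd, fun x => (p x).length, ⟨?_, ?_⟩, hd⟩
  · intro a b
    constructor
    · intro hab
      by_cases hb : b ∈ (p a).support
      · have := hG.isAcyclic.eq_snd_of_adj_start (hp a) hab hb
        refine .inl ⟨?_, this⟩
        rintro rfl
        have h1 := hu a .nil (by simp)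
        rw [← h1] at hb
        simp at hb
        exact hab.ne' hb
      · refine .inr ⟨?_, ?_⟩
        · rintro rfl
          exact hb (by simp)
        · have h1 := hu b (.cons hab.symm (p a)) ((hp a).cons hb)
          change a = (p b).snd
          rw [← h1]
          simp
    · rintro (⟨h1, rfl⟩ | ⟨h1, rfl⟩)
      exacts [hadj _ h1, (hadj _ h1).symm]
  · intro x
    induction h : (p x).length using Nat.strong_induction_on generalizing x with
    | _ n ih =>
      subst h
      by_cases hx : x = v
      · subst hx; exact isBelow_refl _
      · exact ReflTransGen.head ⟨hx, rfl⟩ (ih _ (hd x hx) _ rfl)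

/-- The parent map after a partial Kelmans operation. -/
theorem IsParentMap.pkelmans [DecidableEq V] {G : SimpleGraph V} (hπ : IsParentMap G v π)
    {d : V → ℕ} (hd : ∀ x ≠ v, d (π x) < d x) {u : V} (huv : u ≠ v) (hu : π u = v)
    {W : Finset V} (hW : ∀ w ∈ W, w ≠ v ∧ π w = v ∧ w ≠ u) :
    IsParentMap (pkelmans G v u (W : Set V)) v (fun x => if x ∈ W then u else π x) := by
  have hne : ∀ x ≠ v, π x ≠ x := fun x hx h => by have := hd x hx; rw [h] at this; omega
  have huW : u ∉ W := fun h => (hW u h).2.2 rfl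
  have hvW : v ∉ W := fun h => (hW v h).1 rfl
  refine ⟨?_, ?_⟩
  · intro a b
    simp only [_root_.pkelmans, SimpleGraph.fromRel_adj, hπ.adj_iff, UpStep, Finset.mem_coe]
    grind
  · intro x
    induction h : d x using Nat.strong_induction_on generalizing x with
    | _ n ih =>
      subst h
      by_cases hx : x = v
      · subst hx; exact isBelow_refl _
      by_cases hxW : x ∈ W
      · refine ReflTransGen.head (b := u) ⟨hx, by simp [hxW]⟩ ?_
        exact ReflTransGen.single ⟨huv, by simp [huW, hu]⟩
      · exact ReflTransGen.head (b := π x) ⟨hx, by simp [hxW]⟩ (ih _ (hd x hx) _ rfl)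

end ParentMap

section Accessible

variable [DecidableEq V] {F : Finset (Finset V)}

theorem exists_card_eq_of_accessible
    (hF : ∀ A ∈ F, A.Nonempty → ∃ a ∈ A, A.erase a ∈ F) {A : Finset V} (hA : A ∈ F) {k : ℕ}
    (hk : k ≤ A.card) : ∃ B ∈ F, B.card = k := by
  induction h : A.card generalizing A with
  | zero => exact ⟨A, hA, by omega⟩
  | succ n ih =>
    rcases hk.eq_or_lt with rfl | hk
    · exact ⟨A, hA, rfl⟩
    obtain ⟨a, ha, hB⟩ := hF A hA (card_pos.1 (by omega))
    have := card_erase_of_mem ha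
    exact ih hB (by omega) (by omega)

theorem card_le_card_filter_of_accessible
    (hF : ∀ A ∈ F, A.Nonempty → ∃ a ∈ A, A.erase a ∈ F) {A : Finset V} (hA : A ∈ F) :
    A.card ≤ (F.filter fun B => B.card < A.card).card := by
  calc A.card = (range A.card).card := (card_range _).symm
    _ ≤ ((F.filter fun B => B.card < A.card).image card).card := by
      refine card_le_card fun k hk => ?_
      rw [mem_range] at hk
      obtain ⟨B, hB, rfl⟩ := exists_card_eq_of_accessible hF hA hk.le
      exact mem_image_of_mem _ (by simp [hB, hk])
    _ ≤ _ := card_image_le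

/-- Each pair of members of `F` is counted once, by the comparison of their cardinalities. -/
theorem two_mul_sum_card_filter_lt_add (F : Finset (Finset V)) :
    2 * ∑ A ∈ F, (F.filter fun B => B.card < A.card).card
      + ∑ A ∈ F, (F.filter fun B => B.card = A.card).card = F.card * F.card := by
  have hswap : ∑ A ∈ F, (F.filter fun B => B.card < A.card).card
      = ∑ A ∈ F, (F.filter fun B => A.card < B.card).card := by
    simp only [card_filter]
    exact sum_comm
  rw [two_mul]
  nth_rewrite 2 [hswap]
  rw [← sum_add_distrib, ← sum_add_distrib, ← smul_eq_mul, ← sum_const]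
  refine sum_congr rfl fun A _ => ?_
  rw [← card_union_of_disjoint, ← card_union_of_disjoint]
  · congr 1
    ext B
    simp only [mem_union, mem_filter]
    have := lt_trichotomy B.card A.card
    tauto
  · rw [disjoint_left]; intro B; simp only [mem_union, mem_filter]; omega
  · rw [disjoint_left]; intro B; simp only [mem_filter]; omega

omit [DecidableEq V] in
theorem one_le_card_filter_card_eq {A : Finset V} (hA : A ∈ F) :
    1 ≤ (F.filter fun B => B.card = A.card).card :=
  card_pos.2 ⟨A, by simp [hA]⟩

theorem two_mul_sum_card_add_le
    (hF : ∀ A ∈ F, A.Nonempty → ∃ a ∈ A, A.erase a ∈ F) :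
    2 * ∑ A ∈ F, A.card + F.card ≤ F.card * F.card := by
  rw [← two_mul_sum_card_filter_lt_add F, card_eq_sum_ones F]
  gcongr with A hA A hA
  · exact card_le_card_filter_of_accessible hF hA
  · exact one_le_card_filter_card_eq hA

theorem two_mul_sum_card_add_eq_iff
    (hF : ∀ A ∈ F, A.Nonempty → ∃ a ∈ A, A.erase a ∈ F) :
    2 * ∑ A ∈ F, A.card + F.card = F.card * F.card ↔
      ∀ A ∈ F, ∀ B ∈ F, A.card = B.card → A = B := by
  have h1 : ∑ A ∈ F, A.card ≤ ∑ A ∈ F, (F.filter fun B => B.card < A.card).card :=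
    sum_le_sum fun A hA => card_le_card_filter_of_accessible hF hA
  have h2 : ∑ A ∈ F, 1 ≤ ∑ A ∈ F, (F.filter fun B => B.card = A.card).card :=
    sum_le_sum fun A hA => one_le_card_filter_card_eq hA
  have h3 := two_mul_sum_card_filter_lt_add F
  have h4 := card_eq_sum_ones F
  constructor
  · intro h A hA B hB hAB
    have h5 : ∑ A ∈ F, 1 = ∑ A ∈ F, (F.filter fun B => B.card = A.card).card := by omega
    have h6 := (sum_eq_sum_iff_of_le fun A hA => one_le_card_filter_card_eq hA).1 h5 A hA
    exact card_le_one.1 h6.ge A (by simp [hA]) B (by simp [hB, hAB])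
  · intro h
    have h5 : ∑ A ∈ F, (F.filter fun B => B.card = A.card).card ≤ ∑ A ∈ F, 1 :=
      sum_le_sum fun A hA => card_le_one.2 fun B hB C hC => by
        rw [mem_filter] at hB hC
        exact h B hB.1 C hC.1 (hB.2.trans hC.2.symm)
    have h6 : ∑ A ∈ F, (F.filter fun B => B.card < A.card).card ≤ ∑ A ∈ F, A.card :=
      sum_le_sum fun A hA => by
        rw [← card_range A.card]
        refine card_le_card_of_injOn card (fun B hB => ?_) fun B hB C hC => ?_
        · simpa using (mem_filter.1 hB).2
        · exact h B (mem_filter.1 hB).1 C (mem_filter.1 hC).1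
    omega

end Accessible

section Branches

open Relation

variable {π : V → V} {v : V} {d : V → ℕ}

theorem IsBelow.total {x y z : V} (hy : IsBelow π v x y) (hz : IsBelow π v x z) :
    IsBelow π v y z ∨ IsBelow π v z y :=
  ReflTransGen.total_of_right_unique (fun _ _ _ h h' => h.2.trans h'.2.symm) hy hz

/-- The vertices lying below some member of `S`. -/
def branches (π : V → V) (v : V) (S : Finset V) : Set V := {x | ∃ w ∈ S, IsBelow π v x w}

/-- The subsets of the branches at `S` that are closed under taking parents within them. -/
noncomputable def branchFamily [Fintype V] (π : V → V) (v : V) (S : Finset V) :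
    Finset (Finset V) := by
  classical
  exact univ.filter fun A => (A : Set V) ⊆ branches π v S ∧ UpClosed π S A

/-- The rooted subtrees at `v` that avoid the branches at `S`. -/
noncomputable def avoidFamily [Fintype V] (π : V → V) (v : V) (S : Finset V) :
    Finset (Finset V) := by
  classical
  exact univ.filter fun A => (A : Set V) ⊆ (branches π v S)ᶜ ∧ v ∈ A ∧ UpClosed π {v} A

/-- Every member of `S` is a child of the root. -/
def IsChildSet (π : V → V) (v : V) (S : Finset V) : Prop := ∀ w ∈ S, w ≠ v ∧ π w = v

theorem mem_branchFamily [Fintype V] {S A : Finset V} :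
    A ∈ branchFamily π v S ↔ (A : Set V) ⊆ branches π v S ∧ UpClosed π S A := by
  simp [branchFamily]

theorem mem_avoidFamily [Fintype V] {S A : Finset V} :
    A ∈ avoidFamily π v S ↔ (A : Set V) ⊆ (branches π v S)ᶜ ∧ v ∈ A ∧ UpClosed π {v} A := by
  simp [avoidFamily]

theorem empty_mem_branchFamily [Fintype V] (S : Finset V) : ∅ ∈ branchFamily π v S := by
  simp [mem_branchFamily, UpClosed]

theorem mem_branches_of_mem {S : Finset V} {w : V} (hw : w ∈ S) : w ∈ branches π v S :=
  ⟨w, hw, isBelow_refl w⟩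

theorem singleton_mem_branchFamily [Fintype V] {S : Finset V} {w : V} (hw : w ∈ S) :
    {w} ∈ branchFamily π v S := by
  rw [mem_branchFamily]
  refine ⟨by simpa using mem_branches_of_mem hw, fun x hx hxS => ?_⟩
  rw [mem_singleton] at hx
  exact absurd (hx ▸ hw) hxS

variable {S S' : Finset V}

theorem IsChildSet.root_notMem (hS : IsChildSet π v S) : v ∉ branches π v S := by
  rintro ⟨w, hw, h⟩
  exact (hS w hw).1 h.eq_of_root

theorem IsChildSet.eq_of_isBelow (hS : IsChildSet π v S) {w y : V} (hw : w ∈ S)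
    (h : IsBelow π v w y) (hy : y ≠ v) : w = y := by
  rcases h.cases_head with h | ⟨_, h⟩
  · exact h
  · rw [(hS w hw).2] at h
    exact absurd h.eq_of_root hy

theorem IsChildSet.disjoint_branches (hS : IsChildSet π v S) (hS' : IsChildSet π v S')
    (h : Disjoint S S') : Disjoint (branches π v S) (branches π v S') := by
  rw [Set.disjoint_left]
  rintro x ⟨w, hw, h1⟩ ⟨w', hw', h2⟩
  refine disjoint_left.1 h hw ?_
  rcases h1.total h2 with h3 | h3
  · rwa [hS.eq_of_isBelow hw h3 (hS' w' hw').1]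
  · rwa [← hS'.eq_of_isBelow hw' h3 (hS w hw).1]

theorem parent_mem_branches {x : V} (hx : x ∈ branches π v S) (hxS : x ∉ S) :
    π x ∈ branches π v S := by
  obtain ⟨w, hw, h⟩ := hx
  rcases h.cases_head with rfl | ⟨_, h⟩
  exacts [absurd hw hxS, ⟨w, hw, h⟩]

theorem parent_notMem_branches {x : V} (hx : x ∉ branches π v S) (hxv : x ≠ v) :
    π x ∉ branches π v S := by
  rintro ⟨w, hw, h⟩
  exact hx ⟨w, hw, (isBelow_parent hxv).trans h⟩

theorem IsChildSet.mem_of_isBelow (hS : IsChildSet π v S) {A : Finset V} (hA : UpClosed π S A)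
    {x y : V} (hx : x ∈ A) (h : IsBelow π v x y) (hy : y ≠ v) : y ∈ A := by
  induction h using ReflTransGen.head_induction_on with
  | refl => exact hx
  | @head a c h hc ih =>
    by_cases haS : a ∈ S
    · rwa [← hS.eq_of_isBelow haS (.head h hc) hy]
    · exact ih (h.2 ▸ hA a hx haS)

theorem IsChildSet.exists_mem [Fintype V] (hS : IsChildSet π v S) {A : Finset V}
    (hA : A ∈ branchFamily π v S) (hne : A.Nonempty) : ∃ w ∈ S, w ∈ A := by
  rw [mem_branchFamily] at hA
  obtain ⟨x, hx⟩ := hne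
  obtain ⟨w, hw, h⟩ := hA.1 hx
  exact ⟨w, hw, hS.mem_of_isBelow hA.2 hx h (hS w hw).1⟩

theorem IsChildSet.accessible_branchFamily [Fintype V] [DecidableEq V]
    (hd : ∀ x ≠ v, d (π x) < d x) (hS : IsChildSet π v S) :
    ∀ A ∈ branchFamily π v S, A.Nonempty → ∃ a ∈ A, A.erase a ∈ branchFamily π v S := by
  intro A hA hne
  rw [mem_branchFamily] at hA
  obtain ⟨a, ha, hmax⟩ := A.exists_max_image d hne
  refine ⟨a, ha, mem_branchFamily.2 ⟨fun x hx => hA.1 (mem_of_mem_erase (mem_coe.1 hx)), ?_⟩⟩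
  intro x hx hxS
  have hxA := mem_of_mem_erase hx
  have hxv : x ≠ v := fun h => hS.root_notMem (h ▸ hA.1 hxA)
  refine mem_erase.2 ⟨?_, hA.2 x hxA hxS⟩
  rintro rfl
  exact (hmax x hxA).not_gt (hd x hxv)

theorem card_and_sum_card_eq_of_regions [DecidableEq V] {𝒜 : Finset (Finset V)}
    {𝒯 : Finset (Finset V × Finset V × Finset V)} {N M U : Set V}
    (hNM : Disjoint N M) (hNU : Disjoint N U) (hMU : Disjoint M U) (hcover : N ∪ M ∪ U = Set.univ)
    (hsub : ∀ t ∈ 𝒯, (t.1 : Set V) ⊆ N ∧ (t.2.1 : Set V) ⊆ M ∧ (t.2.2 : Set V) ⊆ U)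
    (hmem : ∀ a b c : Finset V, (a : Set V) ⊆ N → (b : Set V) ⊆ M → (c : Set V) ⊆ U →
      (a ∪ b ∪ c ∈ 𝒜 ↔ (a, b, c) ∈ 𝒯)) :
    𝒜.card = 𝒯.card ∧
      ∑ A ∈ 𝒜, (A.card : ℝ) = ∑ t ∈ 𝒯, ((t.1.card : ℝ) + t.2.1.card + t.2.2.card) := by
  classical
  rw [Set.disjoint_left] at hNM hNU hMU
  have hrec : ∀ t ∈ 𝒯, (t.1 ∪ t.2.1 ∪ t.2.2).filter (· ∈ N) = t.1 ∧
      (t.1 ∪ t.2.1 ∪ t.2.2).filter (· ∈ M) = t.2.1 ∧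
      (t.1 ∪ t.2.1 ∪ t.2.2).filter (· ∈ U) = t.2.2 := by
    intro t ht
    obtain ⟨h1, h2, h3⟩ := hsub t ht
    refine ⟨?_, ?_, ?_⟩ <;> ext x <;>
      have h1' := @h1 x <;> have h2' := @h2 x <;> have h3' := @h3 x <;>
      have k1 := @hNM x <;> have k2 := @hNU x <;> have k3 := @hMU x <;>
      simp only [mem_coe] at h1' h2' h3' <;>
      simp only [mem_filter, mem_union] <;> tauto
  have hdecomp : ∀ A : Finset V,
      A.filter (· ∈ N) ∪ A.filter (· ∈ M) ∪ A.filter (· ∈ U) = A := by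
    intro A
    rw [← filter_or, ← filter_or]
    refine filter_true_of_mem fun x _ => ?_
    have : x ∈ N ∪ M ∪ U := hcover ▸ Set.mem_univ x
    exact this
  have hin : ∀ t ∈ 𝒯, t.1 ∪ t.2.1 ∪ t.2.2 ∈ 𝒜 := fun t ht => by
    obtain ⟨h1, h2, h3⟩ := hsub t ht
    exact (hmem _ _ _ h1 h2 h3).2 ht
  have hinj : ∀ t ∈ 𝒯, ∀ t' ∈ 𝒯, t.1 ∪ t.2.1 ∪ t.2.2 = t'.1 ∪ t'.2.1 ∪ t'.2.2 → t = t' := by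
    intro t ht t' ht' h
    obtain ⟨h1, h2, h3⟩ := hrec t ht
    obtain ⟨h1', h2', h3'⟩ := hrec t' ht'
    rw [h] at h1 h2 h3
    exact Prod.ext (h1.symm.trans h1') (Prod.ext (h2.symm.trans h2') (h3.symm.trans h3'))
  have hsurj : ∀ A ∈ 𝒜, ∃ t, ∃ _ : t ∈ 𝒯, t.1 ∪ t.2.1 ∪ t.2.2 = A := by
    intro A hA
    refine ⟨(A.filter (· ∈ N), A.filter (· ∈ M), A.filter (· ∈ U)), ?_, hdecomp A⟩
    rw [← hmem]
    · rwa [hdecomp]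
    all_goals intro x; simp
  refine ⟨(card_bij (fun t _ => t.1 ∪ t.2.1 ∪ t.2.2) hin
      (fun t ht t' ht' => hinj t ht t' ht') hsurj).symm,
    (sum_bij (fun t _ => t.1 ∪ t.2.1 ∪ t.2.2) hin
      (fun t ht t' ht' => hinj t ht t' ht') hsurj fun t ht => ?_).symm⟩
  obtain ⟨h1, h2, h3⟩ := hsub t ht
  rw [card_union_of_disjoint, card_union_of_disjoint]
  · push_cast; rfl
  · rw [disjoint_left]; exact fun x hx hx' => hNM (h1 hx) (h2 hx')
  · rw [disjoint_left]
    intro x hx hx'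
    rcases mem_union.1 hx with hx | hx
    exacts [hNU (h1 hx) (h3 hx'), hMU (h2 hx) (h3 hx')]

theorem sum_card_product (X Y Z : Finset (Finset V)) :
    ∑ t ∈ X ×ˢ Y ×ˢ Z, ((t.1.card : ℝ) + t.2.1.card + t.2.2.card) =
      (∑ a ∈ X, (a.card : ℝ)) * Y.card * Z.card + X.card * (∑ b ∈ Y, (b.card : ℝ)) * Z.card
        + X.card * Y.card * ∑ c ∈ Z, (c.card : ℝ) := by
  simp only [sum_product, sum_add_distrib, sum_const, nsmul_eq_mul, ← mul_sum,
    card_product]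
  push_cast
  ring

theorem sum_card_erase_empty [DecidableEq V] {Z : Finset (Finset V)} (hZ : ∅ ∈ Z) :
    ∑ c ∈ Z.erase ∅, (c.card : ℝ) = ∑ c ∈ Z, (c.card : ℝ) := by
  rw [← add_sum_erase _ _ hZ]; simp

variable [Fintype V] [DecidableEq V] {G : SimpleGraph V} {u : V} {W : Finset V}

omit [Fintype V] in
theorem branches_insert : branches π v (insert u W) = branches π v W ∪ branches π v {u} := by
  ext x
  simp [branches, or_comm]

theorem union_mem_subtrees_iff (hπ : IsParentMap G v π) (hW : IsChildSet π v W)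
    (hu : IsChildSet π v {u}) (huW : u ∉ W) {a b c : Finset V}
    (ha : (a : Set V) ⊆ (branches π v (insert u W))ᶜ) (hb : (b : Set V) ⊆ branches π v W)
    (hc : (c : Set V) ⊆ branches π v {u}) :
    a ∪ b ∪ c ∈ subtrees G v ↔ (a, b, c) ∈
      avoidFamily π v (insert u W) ×ˢ branchFamily π v W ×ˢ branchFamily π v {u} := by
  have hdisj := hW.disjoint_branches hu (disjoint_singleton_right.2 huW)
  rw [Set.disjoint_left] at hdisj
  have hvM := hW.root_notMem
  have hvU := hu.root_notMem
  have hpar := fun x => parent_notMem_branches (π := π) (v := v) (S := insert u W) (x := x)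
  have hparM := fun x => parent_mem_branches (π := π) (v := v) (S := W) (x := x)
  have hparU := fun x => parent_mem_branches (π := π) (v := v) (S := {u}) (x := x)
  have hWv : ∀ w ∈ W, π w = v := fun w hw => (hW w hw).2
  have huv : π u = v := (hu u (mem_singleton_self u)).2
  have ha' : ∀ x ∈ a, x ∉ branches π v (insert u W) := fun x hx => ha hx
  have hb' : ∀ x ∈ b, x ∈ branches π v W := fun x hx => hb hx
  have hc' : ∀ x ∈ c, x ∈ branches π v {u} := fun x hx => hc hx
  rw [branches_insert] at hpar ha'
  rw [mem_subtrees_iff hπ]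
  simp only [mem_product, mem_avoidFamily, mem_branchFamily, ha, hb, hc, true_and]
  simp only [UpClosed, mem_union, Set.mem_union, Set.mem_singleton_iff, mem_coe,
    mem_singleton] at *
  constructor
  · rintro ⟨h1, h2⟩
    refine ⟨⟨?_, ?_⟩, ?_, ?_⟩ <;> grind
  · rintro ⟨⟨h1, h2⟩, h3, h4⟩
    refine ⟨?_, ?_⟩ <;> grind

theorem union_mem_subtrees_pkelmans_iff (hπ : IsParentMap G v π)
    (hd : ∀ x ≠ v, d (π x) < d x) (hW : IsChildSet π v W)
    (hu : IsChildSet π v {u}) (huW : u ∉ W) {a b c : Finset V}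
    (ha : (a : Set V) ⊆ (branches π v (insert u W))ᶜ) (hb : (b : Set V) ⊆ branches π v W)
    (hc : (c : Set V) ⊆ branches π v {u}) :
    a ∪ b ∪ c ∈ subtrees (pkelmans G v u (W : Set V)) v ↔ (a, b, c) ∈
      avoidFamily π v (insert u W) ×ˢ branchFamily π v W ×ˢ (branchFamily π v {u}).erase ∅ ∪
        avoidFamily π v (insert u W) ×ˢ {∅} ×ˢ {∅} := by
  have hdisj := hW.disjoint_branches hu (disjoint_singleton_right.2 huW)
  rw [Set.disjoint_left] at hdisj
  have hvM := hW.root_notMem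
  have hvU := hu.root_notMem
  have hpar := fun x => parent_notMem_branches (π := π) (v := v) (S := insert u W) (x := x)
  have hparM := fun x => parent_mem_branches (π := π) (v := v) (S := W) (x := x)
  have hparU := fun x => parent_mem_branches (π := π) (v := v) (S := {u}) (x := x)
  have hWv : ∀ w ∈ W, π w = v := fun w hw => (hW w hw).2
  have huv : π u = v := (hu u (mem_singleton_self u)).2
  have ha' : ∀ x ∈ a, x ∉ branches π v (insert u W) := fun x hx => ha hx
  have hb' : ∀ x ∈ b, x ∈ branches π v W := fun x hx => hb hx
  have hc' : ∀ x ∈ c, x ∈ branches π v {u} := fun x hx => hc hx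
  rw [branches_insert] at hpar ha'
  have hpk := hπ.pkelmans (u := u) hd (hu u (mem_singleton_self u)).1 huv
    (W := W) fun w hw => ⟨(hW w hw).1, hWv w hw, fun h => huW (h ▸ hw)⟩
  rw [mem_subtrees_iff hpk]
  have huc : c ∈ branchFamily π v {u} → c.Nonempty → u ∈ c := fun h1 h2 => by
    simpa using hu.exists_mem h1 h2
  have hWb : b ∈ branchFamily π v W → b.Nonempty → ∃ w ∈ W, w ∈ b := hW.exists_mem
  have huU : u ∈ branches π v {u} := mem_branches_of_mem (mem_singleton_self u)
  simp only [nonempty_iff_ne_empty] at huc hWb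
  have hbe : b = ∅ ↔ ∀ x, x ∉ b := eq_empty_iff_forall_notMem
  have hce : c = ∅ ↔ ∀ x, x ∉ c := eq_empty_iff_forall_notMem
  simp only [mem_union, mem_product, mem_avoidFamily, mem_branchFamily, mem_erase, ha, hb, hc,
    true_and] at *
  simp only [UpClosed, mem_union, Set.mem_union, Set.mem_singleton_iff, mem_coe,
    mem_singleton] at *
  constructor
  · rintro ⟨h1, h2⟩
    have hP : ∀ x ∈ b, x ∉ W → π x ∈ b := by grind
    have hR : ∀ x ∈ c, ¬x = u → π x ∈ c := by grind
    have hQ : v ∈ a ∧ ∀ x ∈ a, ¬x = v → π x ∈ a := by grind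
    by_cases hc0 : c = ∅
    · refine .inr ⟨hQ, ?_, hc0⟩
      by_contra hb0
      obtain ⟨w, hwW, hwb⟩ := hWb hP hb0
      have := h2 w (.inl (.inr hwb)) (hW w hwW).1
      rw [if_pos hwW] at this
      subst hc0
      rcases this with (h | h) | h
      · exact ha' _ h (.inr huU)
      · exact hdisj (hb' _ h) huU
      · simp at h
    · exact .inl ⟨hQ, hP, hc0, hR⟩
  · rintro (⟨⟨h1, h2⟩, h3, h4, h5⟩ | ⟨⟨h1, h2⟩, h3, h4⟩)
    · have := huc h5 h4
      refine ⟨?_, ?_⟩ <;> grind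
    · subst h3 h4
      refine ⟨.inl (.inl h1), ?_⟩
      simp only [notMem_empty, or_false]
      intro x hx hxv
      have hxW : x ∉ W := fun h => ha' x hx (.inl (mem_branches_of_mem h))
      rw [if_neg hxW]
      exact h2 x hx hxv

end Branches

section MeanOrder

variable [Fintype V] [DecidableEq V] {G : SimpleGraph V} {π : V → V} {v u : V} {d : V → ℕ}
  {W : Finset V}

omit [Fintype V] in
theorem regions_cover : (branches π v (insert u W))ᶜ ∪ branches π v W ∪ branches π v {u}
    = Set.univ := by
  rw [branches_insert, Set.union_assoc, Set.compl_union_self]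

omit [Fintype V] in
theorem disjoint_compl_branches_left :
    Disjoint (branches π v (insert u W))ᶜ (branches π v W) := by
  rw [branches_insert]
  exact (disjoint_compl_left (a := branches π v W ∪ branches π v {u})).mono_right
    Set.subset_union_left

omit [Fintype V] in
theorem disjoint_compl_branches_right :
    Disjoint (branches π v (insert u W))ᶜ (branches π v {u}) := by
  rw [branches_insert]
  exact (disjoint_compl_left (a := branches π v W ∪ branches π v {u})).mono_right
    Set.subset_union_right

theorem meanOrder_eq (hπ : IsParentMap G v π) (hW : IsChildSet π v W)
    (hu : IsChildSet π v {u}) (huW : u ∉ W) :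
    meanOrder G v =
      ((∑ a ∈ avoidFamily π v (insert u W), (a.card : ℝ)) * (branchFamily π v W).card
          * (branchFamily π v {u}).card
        + (avoidFamily π v (insert u W)).card * (∑ b ∈ branchFamily π v W, (b.card : ℝ))
          * (branchFamily π v {u}).card
        + (avoidFamily π v (insert u W)).card * (branchFamily π v W).card
          * ∑ c ∈ branchFamily π v {u}, (c.card : ℝ)) /
      ((avoidFamily π v (insert u W)).card * (branchFamily π v W).card
        * (branchFamily π v {u}).card) := by
  obtain ⟨h1, h2⟩ := card_and_sum_card_eq_of_regions
    (𝒜 := subtrees G v) (𝒯 := avoidFamily π v (insert u W) ×ˢ branchFamily π v W ×ˢ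
      branchFamily π v {u})
    disjoint_compl_branches_left disjoint_compl_branches_right
    (hW.disjoint_branches hu (disjoint_singleton_right.2 huW)) regions_cover
    (fun t ht => by
      simp only [mem_product, mem_avoidFamily, mem_branchFamily] at ht
      exact ⟨ht.1.1, ht.2.1.1, ht.2.2.1⟩)
    fun a b c ha hb hc => union_mem_subtrees_iff hπ hW hu huW ha hb hc
  rw [meanOrder, h1, h2, sum_card_product, card_product, card_product]
  push_cast
  rw [mul_assoc ((avoidFamily π v (insert u W)).card : ℝ)
    ((branchFamily π v W).card : ℝ) ((branchFamily π v {u}).card : ℝ)]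

theorem meanOrder_pkelmans_eq (hπ : IsParentMap G v π) (hd : ∀ x ≠ v, d (π x) < d x)
    (hW : IsChildSet π v W) (hu : IsChildSet π v {u}) (huW : u ∉ W) :
    meanOrder (pkelmans G v u (W : Set V)) v =
      ((∑ a ∈ avoidFamily π v (insert u W), (a.card : ℝ)) * (branchFamily π v W).card
          * ((branchFamily π v {u}).erase ∅).card
        + (avoidFamily π v (insert u W)).card * (∑ b ∈ branchFamily π v W, (b.card : ℝ))
          * ((branchFamily π v {u}).erase ∅).card
        + (avoidFamily π v (insert u W)).card * (branchFamily π v W).card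
          * (∑ c ∈ branchFamily π v {u}, (c.card : ℝ))
        + ∑ a ∈ avoidFamily π v (insert u W), (a.card : ℝ)) /
      ((avoidFamily π v (insert u W)).card * (branchFamily π v W).card
        * ((branchFamily π v {u}).erase ∅).card + (avoidFamily π v (insert u W)).card) := by
  have hdisj : Disjoint
      (avoidFamily π v (insert u W) ×ˢ branchFamily π v W ×ˢ (branchFamily π v {u}).erase ∅)
      (avoidFamily π v (insert u W) ×ˢ {∅} ×ˢ {∅}) := by
    rw [disjoint_left]
    intro t ht ht'
    simp only [mem_product, mem_erase, mem_singleton] at ht ht'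
    exact ht.2.2.1 ht'.2.2
  obtain ⟨h1, h2⟩ := card_and_sum_card_eq_of_regions
    (𝒜 := subtrees (pkelmans G v u (W : Set V)) v)
    (𝒯 := avoidFamily π v (insert u W) ×ˢ branchFamily π v W ×ˢ (branchFamily π v {u}).erase ∅ ∪
        avoidFamily π v (insert u W) ×ˢ {∅} ×ˢ {∅})
    disjoint_compl_branches_left disjoint_compl_branches_right
    (hW.disjoint_branches hu (disjoint_singleton_right.2 huW)) regions_cover
    (fun t ht => by
      simp only [mem_union, mem_product, mem_avoidFamily, mem_branchFamily, mem_erase,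
        mem_singleton] at ht
      rcases ht with ht | ht
      · exact ⟨ht.1.1, ht.2.1.1, ht.2.2.2.1⟩
      · simp [ht.1.1, ht.2.1, ht.2.2])
    fun a b c ha hb hc => union_mem_subtrees_pkelmans_iff hπ hd hW hu huW ha hb hc
  rw [meanOrder, h1, h2, sum_union hdisj, card_union_of_disjoint hdisj, sum_card_product,
    sum_card_product, sum_card_erase_empty (empty_mem_branchFamily _)]
  simp [mul_assoc]

omit [DecidableEq V] in
theorem card_avoidFamily_pos {S : Finset V} (hS : IsChildSet π v S) :
    0 < (avoidFamily π v S).card := by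
  refine card_pos.2 ⟨{v}, mem_avoidFamily.2 ⟨?_, mem_singleton_self v, ?_⟩⟩
  · simpa using hS.root_notMem
  · intro x hx hxv
    exact absurd (mem_singleton.1 hx) hxv

theorem meanOrder_pkelmans_sub (hπ : IsParentMap G v π) (hd : ∀ x ≠ v, d (π x) < d x)
    (hW : IsChildSet π v W) (hu : IsChildSet π v {u}) (huW : u ∉ W) :
    meanOrder (pkelmans G v u (W : Set V)) v - meanOrder G v =
      ((∑ c ∈ branchFamily π v {u}, (c.card : ℝ)) * (branchFamily π v W).card
          * ((branchFamily π v W).card - 1)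
        - (∑ b ∈ branchFamily π v W, (b.card : ℝ)) * (branchFamily π v {u}).card) /
      (((branchFamily π v W).card * ((branchFamily π v {u}).erase ∅).card + 1)
        * (branchFamily π v {u}).card * (branchFamily π v W).card) := by
  have hr := card_erase_add_one (empty_mem_branchFamily (π := π) (v := v) {u})
  have hp : 0 < (branchFamily π v W).card := card_pos.2 ⟨∅, empty_mem_branchFamily _⟩
  have hq : 0 < (avoidFamily π v (insert u W)).card := by
    refine card_avoidFamily_pos fun w hw => ?_
    rcases mem_insert.1 hw with rfl | hw
    exacts [hu w (mem_singleton_self w), hW w hw]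
  rw [meanOrder_eq hπ hW hu huW, meanOrder_pkelmans_eq hπ hd hW hu huW, ← hr]
  generalize ((branchFamily π v {u}).erase ∅).card = r
  generalize (branchFamily π v W).card = p at *
  generalize (avoidFamily π v (insert u W)).card = q at *
  have hp' : (0 : ℝ) < p := by exact_mod_cast hp
  have hq' : (0 : ℝ) < q := by exact_mod_cast hq
  have h1 : (q * p * r + q : ℝ) ≠ 0 := by positivity
  have h2 : (p * r + 1 : ℝ) ≠ 0 := by positivity
  have h3 : ((r + 1 : ℕ) : ℝ) ≠ 0 := by positivity
  push_cast at *
  field_simp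
  ring

theorem two_mul_sum_card_branchFamily_singleton_ge (hd : ∀ x ≠ v, d (π x) < d x)
    (hu : IsChildSet π v {u}) :
    (branchFamily π v {u}).card ≤ 2 * ∑ c ∈ branchFamily π v {u}, c.card ∧
      ((branchFamily π v {u}).card = 2 * ∑ c ∈ branchFamily π v {u}, c.card ↔
        (branchFamily π v {u}).card = 2) := by
  have hr := card_erase_add_one (empty_mem_branchFamily (π := π) (v := v) {u})
  have hmem : {u} ∈ (branchFamily π v {u}).erase ∅ :=
    mem_erase.2 ⟨singleton_ne_empty u, singleton_mem_branchFamily (mem_singleton_self u)⟩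
  have hr1 : 0 < ((branchFamily π v {u}).erase ∅).card := card_pos.2 ⟨_, hmem⟩
  have hle : ((branchFamily π v {u}).erase ∅).card ≤ ∑ c ∈ branchFamily π v {u}, c.card := by
    rw [← add_sum_erase _ _ (empty_mem_branchFamily _), card_eq_sum_ones]
    refine (sum_le_sum fun c hc => ?_).trans (Nat.le_add_left _ _)
    exact card_pos.2 (nonempty_iff_ne_empty.2 (ne_of_mem_erase hc))
  have hacc := two_mul_sum_card_add_le (hu.accessible_branchFamily hd)
  refine ⟨by omega, by omega, fun h => ?_⟩
  rw [h] at hacc hr ⊢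
  omega

theorem meanOrder_pkelmans_ge_and_eq_iff (hπ : IsParentMap G v π)
    (hd : ∀ x ≠ v, d (π x) < d x)
    (hW : IsChildSet π v W) (hu : IsChildSet π v {u}) (huW : u ∉ W) :
    meanOrder G v ≤ meanOrder (pkelmans G v u (W : Set V)) v ∧
      (meanOrder (pkelmans G v u (W : Set V)) v = meanOrder G v ↔
        (branchFamily π v W).card = 1 ∨ (branchFamily π v {u}).card = 2 ∧
          ∀ A ∈ branchFamily π v W, ∀ B ∈ branchFamily π v W, A.card = B.card → A = B) := by
  obtain ⟨h1, h2⟩ := two_mul_sum_card_branchFamily_singleton_ge hd hu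
  have h3 := two_mul_sum_card_add_le (hW.accessible_branchFamily hd)
  have h4 := two_mul_sum_card_add_eq_iff (hW.accessible_branchFamily hd)
  have h5 : 0 < (branchFamily π v W).card := card_pos.2 ⟨∅, empty_mem_branchFamily _⟩
  have h6 : 0 < (branchFamily π v {u}).card := card_pos.2 ⟨∅, empty_mem_branchFamily _⟩
  have hsub := meanOrder_pkelmans_sub hπ hd hW hu huW
  rw [← h2, ← h4]
  simp only [← Nat.cast_sum] at hsub
  generalize ∑ c ∈ branchFamily π v {u}, c.card = s at *
  generalize ∑ c ∈ branchFamily π v W, c.card = t at *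
  generalize ((branchFamily π v {u}).erase ∅).card = r at *
  generalize (branchFamily π v W).card = p at *
  generalize (branchFamily π v {u}).card = n at *
  have hx : (0 : ℝ) ≤ (2 * s - n) * (p * (p - 1)) := by
    have a1 : (n : ℝ) ≤ 2 * s := by exact_mod_cast h1
    have a2 : (1 : ℝ) ≤ p := by exact_mod_cast h5
    exact mul_nonneg (by linarith) (mul_nonneg (by linarith) (by linarith))
  have hn : (0 : ℝ) < n := by exact_mod_cast h6
  have hy : (0 : ℝ) ≤ n * (p * p - p - 2 * t) := by
    have a1 : (2 * t + p : ℝ) ≤ p * p := by exact_mod_cast h3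
    exact mul_nonneg hn.le (by linarith)
  have hp : (0 : ℝ) < p := by exact_mod_cast h5
  have hD : (0 : ℝ) < (p * r + 1) * n * p := by positivity
  have hnum : (s : ℝ) * p * (p - 1) - t * n =
      ((2 * s - n) * (p * (p - 1)) + n * (p * p - p - 2 * t)) / 2 := by ring
  rw [hnum] at hsub
  refine ⟨sub_nonneg.1 (hsub ▸ by positivity), ?_⟩
  rw [← sub_eq_zero, hsub, div_eq_zero_iff, or_iff_left hD.ne', div_eq_zero_iff,
    or_iff_left two_ne_zero, add_eq_zero_iff_of_nonneg hx hy, mul_eq_zero, mul_eq_zero, mul_eq_zero,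
    or_iff_right hp.ne', or_iff_right hn.ne']
  have e1 : (2 * s - n : ℝ) = 0 ↔ n = 2 * s := by
    rw [sub_eq_zero, eq_comm]; norm_cast
  have e2 : (p - 1 : ℝ) = 0 ↔ p = 1 := by
    rw [sub_eq_zero]; norm_cast
  have e3 : (p * p - p - 2 * t : ℝ) = 0 ↔ 2 * t + p = p * p := by
    rw [sub_sub, sub_eq_zero, eq_comm, add_comm]; norm_cast
  rw [e1, e2, e3]
  constructor
  · tauto
  · rintro (rfl | h)
    · exact ⟨.inr rfl, by omega⟩
    · exact ⟨.inl h.1, h.2⟩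

end MeanOrder

section Equality

open Relation

variable {G : SimpleGraph V} {π : V → V} {v u : V} {d : V → ℕ} {W S : Finset V}

/-- No vertex of the branches at `S` has two children. -/
def IsUnforked (π : V → V) (v : V) (S : Finset V) : Prop :=
  ∀ y z, y ≠ v → z ≠ v → π y ∈ branches π v S → π y = π z → y = z

theorem card_branchFamily_eq_one_iff [Fintype V] :
    (branchFamily π v W).card = 1 ↔ W = ∅ := by
  rw [card_eq_one]
  constructor
  · rintro ⟨A, hA⟩
    by_contra hW
    obtain ⟨w, hw⟩ := nonempty_iff_ne_empty.2 hW
    have h1 := singleton_mem_branchFamily (π := π) (v := v) hw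
    have h2 := empty_mem_branchFamily (π := π) (v := v) W
    rw [hA, mem_singleton] at h1 h2
    exact singleton_ne_empty w (h1.trans h2.symm)
  · rintro rfl
    refine ⟨∅, eq_singleton_iff_unique_mem.2 ⟨empty_mem_branchFamily _, fun A hA => ?_⟩⟩
    rw [mem_branchFamily] at hA
    refine eq_empty_of_forall_notMem fun x hx => ?_
    obtain ⟨w, hw, _⟩ := hA.1 hx
    simp at hw

theorem card_branchFamily_singleton_eq_two_iff [Fintype V] [DecidableEq V]
    (hπ : IsParentMap G v π)
    (hd : ∀ x ≠ v, d (π x) < d x) (hu : IsChildSet π v {u}) :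
    (branchFamily π v {u}).card = 2 ↔ (G.neighborSet u).ncard = 1 := by
  obtain ⟨huv, huπ⟩ := hu u (mem_singleton_self u)
  have hv : v ∈ G.neighborSet u := (hπ.adj_iff u v).2 (.inl ⟨huv, huπ.symm⟩)
  have hsub : {∅, {u}} ⊆ branchFamily π v {u} := by
    intro A hA
    rcases mem_insert.1 hA with rfl | hA
    · exact empty_mem_branchFamily _
    · rw [mem_singleton.1 hA]; exact singleton_mem_branchFamily (mem_singleton_self u)
  have hcard : ({∅, {u}} : Finset (Finset V)).card = 2 :=
    card_pair (singleton_ne_empty u).symm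
  have key : (G.neighborSet u).ncard = 1 ↔ ∀ y ≠ v, π y ≠ u := by
    rw [Set.ncard_eq_one]
    constructor
    · rintro ⟨a, ha⟩ y hy hyu
      have h1 : y ∈ G.neighborSet u := (hπ.adj_iff u y).2 (.inr ⟨hy, hyu.symm⟩)
      rw [ha] at h1 hv
      exact hy (h1.trans hv.symm)
    · intro h
      refine ⟨v, Set.eq_singleton_iff_unique_mem.2 ⟨hv, fun y hy => ?_⟩⟩
      rcases (hπ.adj_iff u y).1 hy with h1 | h1
      · exact h1.2.trans huπ
      · exact absurd h1.2.symm (h y h1.1)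
  rw [key]
  constructor
  · intro h y hy hyu
    have heq := eq_of_subset_of_card_le hsub (by rw [h, hcard])
    have hyne : y ≠ u := fun h => by have := hd y hy; rw [hyu, h] at this; omega
    have hmem : {u, y} ∈ branchFamily π v {u} := by
      rw [mem_branchFamily]
      refine ⟨?_, ?_⟩
      · intro x hx
        have hx : x = u ∨ x = y := by simpa using hx
        rcases hx with rfl | rfl
        · exact mem_branches_of_mem (mem_singleton_self x)
        · exact ⟨u, mem_singleton_self u, hyu ▸ isBelow_parent hy⟩
      · intro x hx hxu
        have hx : x = u ∨ x = y := by simpa using hx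
        rcases hx with rfl | rfl
        · simp at hxu
        · simp [hyu]
    rw [← heq, mem_insert, mem_singleton] at hmem
    rcases hmem with h | h
    · simp at h
    · have : y ∈ ({u, y} : Finset V) := by simp
      rw [h, mem_singleton] at this
      exact hyne this
  · intro h
    rw [← hcard]
    congr 1
    refine (hsub.antisymm fun A hA => ?_).symm
    rw [mem_branchFamily] at hA
    have : A ⊆ {u} := by
      intro x hx
      obtain ⟨w, hw, hb⟩ := hA.1 hx
      rw [mem_singleton] at hw
      subst hw
      rcases hb.cases_tail with rfl | ⟨z, hz, hzu, _⟩
      · simp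
      · exact absurd hzu (h z hz)
    rw [mem_insert, mem_singleton]
    exact subset_singleton_iff.1 this

theorem IsUnforked.total {w : V} (h : IsUnforked π v {w}) {x y : V} (hx : IsBelow π v x w)
    (hy : IsBelow π v y w) : IsBelow π v x y ∨ IsBelow π v y x := by
  induction hx using ReflTransGen.head_induction_on with
  | refl => exact .inr hy
  | @head a c hac hc ih =>
    obtain ⟨hav, rfl⟩ := hac
    rcases ih with ih | ih
    · exact .inl ((isBelow_parent hav).trans ih)
    · rcases ih.cases_tail with rfl | ⟨z, hz, hza, hyz⟩
      · exact .inl (isBelow_parent hav)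
      · have : a = z := h a z hav hz ⟨w, mem_singleton_self w, hc⟩ hza.symm
        exact .inr (this ▸ hyz)

theorem exists_fork_sets [Fintype V] [DecidableEq V] (hd : ∀ x ≠ v, d (π x) < d x)
    (hS : IsChildSet π v S) {y : V} (hy : y ≠ v) (hyS : π y ∈ branches π v S) :
    ∃ A : Finset V, (∀ x, x ∈ A ↔ x ∈ branches π v S ∧ IsBelow π v (π y) x) ∧
      y ∉ A ∧ insert y A ∈ branchFamily π v S := by
  classical
  refine ⟨univ.filter fun x => x ∈ branches π v S ∧ IsBelow π v (π y) x, by simp, ?_, ?_⟩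
  · intro h
    have h1 := (mem_filter.1 h).2.2.depth_le hd
    have h2 := hd y hy
    omega
  · rw [mem_branchFamily]
    constructor
    · intro x hx
      simp only [coe_insert, coe_filter, mem_univ, true_and, Set.mem_insert_iff,
        Set.mem_ofPred_eq] at hx
      rcases hx with rfl | hx
      · obtain ⟨w, hw, hb⟩ := hyS
        exact ⟨w, hw, (isBelow_parent hy).trans hb⟩
      · exact hx.1
    · intro x hx hxS
      simp only [mem_insert, mem_filter, mem_univ, true_and] at hx ⊢
      rcases hx with rfl | hx
      · exact .inr ⟨hyS, isBelow_refl _⟩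
      · have hxv : x ≠ v := fun h => hS.root_notMem (h ▸ hx.1)
        exact .inr ⟨parent_mem_branches hx.1 hxS, hx.2.trans (isBelow_parent hxv)⟩

theorem card_injective_iff [Fintype V] (hd : ∀ x ≠ v, d (π x) < d x)
    (hW : IsChildSet π v W) (hne : W.Nonempty) :
    (∀ A ∈ branchFamily π v W, ∀ B ∈ branchFamily π v W, A.card = B.card → A = B) ↔
      ∃ w, W = {w} ∧ IsUnforked π v {w} := by
  classical
  constructor
  · intro h
    obtain ⟨w, hw⟩ := hne
    have hWw : W = {w} := by
      refine eq_singleton_iff_unique_mem.2 ⟨hw, fun x hx => ?_⟩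
      exact singleton_injective (h _ (singleton_mem_branchFamily hx) _
        (singleton_mem_branchFamily hw) (by simp))
    refine ⟨w, hWw, ?_⟩
    rw [← hWw]
    intro y z hy hz hyW hyz
    obtain ⟨A, hA, hyA, hA'⟩ := exists_fork_sets hd hW hy hyW
    obtain ⟨B, hB, hzB, hB'⟩ := exists_fork_sets hd hW hz (hyz ▸ hyW)
    have hAB : A = B := by ext x; rw [hA, hB, hyz]
    subst hAB
    have := h _ hA' _ hB' (by rw [card_insert_of_notMem hyA, card_insert_of_notMem hzB])
    have hmem : y ∈ insert z A := this ▸ mem_insert_self y A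
    exact (mem_insert.1 hmem).resolve_right hyA
  · rintro ⟨w, rfl, h⟩ A hA B hB hAB
    rw [mem_branchFamily] at hA hB
    have hroot := hW.root_notMem
    by_cases hsub : A ⊆ B
    · exact eq_of_subset_of_card_le hsub hAB.ge
    · obtain ⟨a, ha, haB⟩ := not_subset.1 hsub
      refine (eq_of_subset_of_card_le (fun b hb => ?_) hAB.le).symm
      have hbelow : ∀ x ∈ branches π v {w}, IsBelow π v x w := by
        rintro x ⟨w', hw', h⟩
        rwa [mem_singleton.1 hw'] at h
      have haw := hA.1 ha
      have hbw := hB.1 hb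
      rcases h.total (hbelow a haw) (hbelow b hbw) with h1 | h1
      · exact hW.mem_of_isBelow hA.2 ha h1 fun e => hroot (e ▸ hbw)
      · exact absurd (hW.mem_of_isBelow hB.2 hb h1 fun e => hroot (e ▸ haw)) haB

theorem compDel_eq_branches (hπ : IsParentMap G v π) (hu : IsChildSet π v {u}) {w : V}
    (hw : IsChildSet π v {w}) (huw : w ≠ u) : compDel G {u, v} w = branches π v {w} := by
  obtain ⟨hwv, hwπ⟩ := hw w (mem_singleton_self w)
  obtain ⟨huv, huπ⟩ := hu u (mem_singleton_self u)
  ext x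
  constructor
  · rintro ⟨p, hp⟩
    have key : ∀ a b (p : G.Walk a b), (∀ y ∈ p.support, y ∉ ({u, v} : Set V)) →
        a ∈ branches π v {w} → b ∈ branches π v {w} := by
      intro a b p
      induction p with
      | nil => exact fun _ h => h
      | @cons a c _ hadj p ih =>
        intro hp ha
        simp only [SimpleGraph.Walk.support_cons, List.mem_cons, forall_eq_or_imp] at hp
        refine ih hp.2 ?_
        rcases (hπ.adj_iff _ _).1 hadj with ⟨h1, rfl⟩ | ⟨h1, rfl⟩
        · refine parent_mem_branches ha fun haw => ?_
          rw [mem_singleton] at haw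
          refine hp.2 _ p.start_mem_support ?_
          simp [haw, hwπ]
        · obtain ⟨w', hw', h⟩ := ha
          exact ⟨w', hw', (isBelow_parent h1).trans h⟩
    exact key _ _ p hp (mem_branches_of_mem (mem_singleton_self w))
  · rintro ⟨w', hw', h⟩
    rw [mem_singleton] at hw'
    subst hw'
    have hD : ∀ y, IsBelow π v y w' → y ∉ ({u, v} : Set V) := by
      intro y hy hyD
      rcases hyD with rfl | hyv
      · exact huw (hu.eq_of_isBelow (mem_singleton_self y) hy hwv).symm
      · rw [Set.mem_singleton_iff] at hyv
        exact hwv (hyv ▸ hy).eq_of_root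
    induction h using ReflTransGen.head_induction_on with
    | refl => exact ⟨.nil, by simpa using hD w' (isBelow_refl _)⟩
    | @head a c hac hc ih =>
      obtain ⟨p, hp⟩ := ih
      refine ⟨p.concat ((hπ.adj_iff c a).2 (.inr hac)), ?_⟩
      intro y hy
      rw [SimpleGraph.Walk.support_concat, List.mem_append, List.mem_singleton] at hy
      rcases hy with hy | rfl
      · exact hp y hy
      · exact hD y (.head hac hc)

theorem isPathOn_branches_iff [Finite V] (hπ : IsParentMap G v π)
    (hd : ∀ x ≠ v, d (π x) < d x) {w : V} (hw : IsChildSet π v {w}) :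
    IsPathOn G (branches π v {w}) ∧ (G.neighborSet w ∩ branches π v {w}).ncard ≤ 1 ↔
      IsUnforked π v {w} := by
  obtain ⟨hwv, hwπ⟩ := hw w (mem_singleton_self w)
  have hwK : w ∈ branches π v {w} := mem_branches_of_mem (mem_singleton_self w)
  have hroot := hw.root_notMem
  have hchild : ∀ x ∈ branches π v {w}, ∀ y, y ≠ v → π y = x → y ∈ branches π v {w} := by
    rintro x ⟨w', hw', h⟩ y hy rfl
    exact ⟨w', hw', (isBelow_parent hy).trans h⟩
  have hconn : (G.induce (branches π v {w})).Connected := by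
    refine hπ.induce_connected hwK (fun x hx hxw => parent_mem_branches hx (by simpa using hxw)) ?_
    rintro x ⟨w', hw', h⟩
    rwa [mem_singleton.1 hw'] at h
  have hnw : G.neighborSet w ∩ branches π v {w} = {y | y ≠ v ∧ π y = w} := by
    ext y
    simp only [Set.mem_inter_iff, SimpleGraph.mem_neighborSet, hπ.adj_iff, UpStep,
      Set.mem_ofPred_eq]
    constructor
    · rintro ⟨⟨_, rfl⟩ | ⟨h1, h2⟩, h3⟩
      · exact absurd (hwπ ▸ h3) hroot
      · exact ⟨h1, h2.symm⟩
    · rintro ⟨h1, h2⟩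
      exact ⟨.inr ⟨h1, h2.symm⟩, hchild w hwK y h1 h2⟩
  have hnx : ∀ x ∈ branches π v {w}, x ≠ w →
      (G.neighborSet x ∩ branches π v {w}).ncard = {y | y ≠ v ∧ π y = x}.ncard + 1 := by
    intro x hx hxw
    have hxv : x ≠ v := fun h => hroot (h ▸ hx)
    have hpx : π x ∈ branches π v {w} := parent_mem_branches hx (by simpa using hxw)
    have heq : G.neighborSet x ∩ branches π v {w} = insert (π x) {y | y ≠ v ∧ π y = x} := by
      ext y
      simp only [Set.mem_inter_iff, SimpleGraph.mem_neighborSet, hπ.adj_iff, UpStep,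
        Set.mem_ofPred_eq, Set.mem_insert_iff]
      constructor
      · rintro ⟨⟨_, h⟩ | ⟨h1, h2⟩, h3⟩
        · exact .inl h
        · exact .inr ⟨h1, h2.symm⟩
      · rintro (rfl | ⟨h1, h2⟩)
        · exact ⟨.inl ⟨hxv, rfl⟩, hpx⟩
        · exact ⟨.inr ⟨h1, h2.symm⟩, hchild x hx y h1 h2⟩
    rw [heq, Set.ncard_insert_of_notMem]
    rintro ⟨h1, h2⟩
    have := hd _ h1
    have := hd _ hxv
    rw [h2] at *
    omega
  have hunf : IsUnforked π v {w} ↔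
      ∀ x ∈ branches π v {w}, {y | y ≠ v ∧ π y = x}.ncard ≤ 1 := by
    constructor
    · intro h x hx
      rw [Set.ncard_le_one_iff]
      rintro y z ⟨hy, rfl⟩ ⟨hz, hzy⟩
      exact h y z hy hz hx hzy.symm
    · intro h y z hy hz hyK hyz
      exact (Set.ncard_le_one_iff (Set.toFinite _)).1 (h _ hyK) ⟨hy, rfl⟩ ⟨hz, hyz.symm⟩
  rw [hunf]
  constructor
  · rintro ⟨⟨_, h1⟩, h2⟩ x hx
    by_cases hxw : x = w
    · rw [hxw, ← hnw]; exact h2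
    · have := h1 x hx
      rw [hnx x hx hxw] at this
      omega
  · intro h
    have h2 : (G.neighborSet w ∩ branches π v {w}).ncard ≤ 1 := hnw ▸ h w hwK
    refine ⟨⟨hconn, fun x hx => ?_⟩, h2⟩
    by_cases hxw : x = w
    · rw [hxw]; omega
    · rw [hnx x hx hxw]
      have := h x hx
      omega

end Equality

/-- For adjacent vertices `u, v` of a tree `T` and `T'` obtained by a
partial Kelmans operation from `v` to `u` moving the edges from `v` to a set
`W ⊆ N(v) \ {u}`: `μ(T'; v) ≥ μ(T; v)`.  Equality holds iff `W = ∅` (no operation), or: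
`u` is a leaf of `T`, `W = {v₁}` is a single vertex, and the component of `T - {u,v}`
containing `v₁` is a path with `v₁` as a leaf. -/
theorem pkelmans_meanOrder_ge {V : Type*} [Fintype V] [DecidableEq V]
    (G : SimpleGraph V) (hG : G.IsTree) (u v : V) (huv : G.Adj u v)
    (W : Finset V) (hW : ∀ w ∈ W, G.Adj v w ∧ w ≠ u) :
    meanOrder (pkelmans G v u (W : Set V)) v ≥ meanOrder G v ∧
      (meanOrder (pkelmans G v u (W : Set V)) v = meanOrder G v ↔
        W = ∅ ∨
          ((G.neighborSet u).ncard = 1 ∧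
            ∃ v₁ : V, W = {v₁} ∧
              IsPathOn G (compDel G {u, v} v₁) ∧
              (G.neighborSet v₁ ∩ compDel G {u, v} v₁).ncard ≤ 1)) := by
  obtain ⟨π, d, hπ, hd⟩ := exists_isParentMap hG v
  have hchild : ∀ w, G.Adj v w → w ≠ v ∧ π w = v := by
    intro w hw
    rcases (hπ.adj_iff v w).1 hw with h | h
    · exact absurd rfl h.1
    · exact ⟨h.1, h.2.symm⟩
  have hWc : IsChildSet π v W := fun w hw => hchild w (hW w hw).1
  have hu : IsChildSet π v {u} := fun x hx => by
    rw [mem_singleton.1 hx]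
    exact hchild u huv.symm
  have huW : u ∉ W := fun h => (hW u h).2 rfl
  obtain ⟨h1, h2⟩ := meanOrder_pkelmans_ge_and_eq_iff hπ hd hWc hu huW
  refine ⟨h1, h2.trans ?_⟩
  rw [card_branchFamily_eq_one_iff, card_branchFamily_singleton_eq_two_iff hπ hd hu]
  rcases W.eq_empty_or_nonempty with hW0 | hW0
  · simp [hW0]
  · rw [card_injective_iff hd hWc hW0]
    refine or_congr_right (and_congr_right fun _ => exists_congr fun w => and_congr_right ?_)
    intro hw
    have hwc : IsChildSet π v {w} := hw ▸ hWc
    have hwu : w ≠ u := (hW w (hw ▸ mem_singleton_self w)).2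
    rw [compDel_eq_branches hπ hu hwc hwu, isPathOn_branches_iff hπ hd hwc]
end
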